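/- arXiv:1505.08169 — 5 statements merged into one kernel-verified Lean document; each statement's English description precedes it below -/
import Mathlib

section
/- For every θ ∈ (0,1), M > 0, and 0 < v₀ ≤ v₁, there exists a constant c > 0, depending only on θ, M, v₀, v₁, with the following property. For every nonempty finite type K, every symmetric c : K → K → ℝ with c x y ≥ 0, every κ : K → ℝ with κ x ≥ θ for all x, the associated ferromagnetic Gaussian Gibbs measure μ satisfying v₀ ≤ ∫ (φ x)² dμ(φ) ≤ v₁ for all x ∈ K, every increasing set A ⊆ (K → Bool) and every h ∈ (−M, M) with 0 < μ(A^h) < 1 and m := max_{x∈K} I_μ(A^h, x) > 0: −(deriv of the function h ↦ (μ(A^h)).toReal at h) ≥ c · μ(A^h)·(1 − μ(A^h)) · log(1/(2m)). (Differential inequality of Corollary 4.4, equation (4.10).) -/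
open MeasureTheory Real

/-- The level-set event `A^h = {φ | (1{h ≤ φ x})_x ∈ A}`. -/
def levSet {K : Type} (A : Set (K → Bool)) (h : ℝ) : Set (K → ℝ) :=
  {φ | (fun x => decide (h ≤ φ x)) ∈ A}

/-- The conditional influence `I_μ(A^h, x)`. -/
noncomputable def condInfl {K : Type} (μ : Measure (K → ℝ))
    (A : Set (K → Bool)) (h : ℝ) (x : K) : ℝ :=
  (μ (levSet A h ∩ {φ | h ≤ φ x})).toReal / (μ {φ : K → ℝ | h ≤ φ x}).toReal
    - (μ (levSet A h ∩ {φ | φ x < h})).toReal / (μ {φ : K → ℝ | φ x < h}).toReal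

/-! ### A sharp threshold inequality on binary decision trees -/

/-- A binary tree describing sequentially revealed bits: at `node p t₁ t₀` the next bit is `1` with
probability `p`, and a leaf carries the final value of the observable. -/
inductive BitTree where
  | leaf (a : ℝ)
  | node (p : ℝ) (t₁ t₀ : BitTree)

namespace BitTree

/-- Expected value of the observable. -/
def mean : BitTree → ℝ
  | leaf a => a
  | node p t₁ t₀ => p * mean t₁ + (1 - p) * mean t₀

/-- Expectation of `F p (mean t₁) (mean t₀)` over the random node of depth `k`. -/
def level (F : ℝ → ℝ → ℝ → ℝ) : BitTree → ℕ → ℝ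
  | leaf _, _ => 0
  | node p t₁ t₀, 0 => F p (mean t₁) (mean t₀)
  | node p t₁ t₀, k + 1 => p * level F t₁ k + (1 - p) * level F t₀ k

/-- `Dom n t t'`: the trees have depth `n`, `{0, 1}`-valued leaves, and `t` dominates `t'` in every
monotone coupling of the bits. -/
inductive Dom : ℕ → BitTree → BitTree → Prop
  | ofLeaf {a b : ℝ} (ha : a = 0 ∨ a = 1) (hb : b = 0 ∨ b = 1) (hab : b ≤ a) :
      Dom 0 (leaf a) (leaf b)
  | ofNode {n : ℕ} {p p' : ℝ} {t₁ t₀ t₁' t₀' : BitTree} (h0 : 0 ≤ p') (hp : p' ≤ p) (h1 : p ≤ 1)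
      (h₁₁ : Dom n t₁ t₁') (h₁₀ : Dom n t₁ t₀') (h₀₀ : Dom n t₀ t₀') :
      Dom (n + 1) (node p t₁ t₀) (node p' t₁' t₀')

/-- Expected squared martingale increment at depth `k`. -/
def incSq : BitTree → ℕ → ℝ := level fun p a b => p * (1 - p) * (a - b) ^ 2

/-- Influence of the bit at depth `k`, given the previous bits. -/
def influence : BitTree → ℕ → ℝ := level fun _ a b => a - b

lemma mix_mono {p p' x₁ x₀ y₁ y₀ : ℝ} (h0 : 0 ≤ p') (hp : p' ≤ p) (h1 : p ≤ 1)
    (h₁₁ : y₁ ≤ x₁) (h₁₀ : y₀ ≤ x₁) (h₀₀ : y₀ ≤ x₀) :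
    p' * y₁ + (1 - p') * y₀ ≤ p * x₁ + (1 - p) * x₀ := by
  nlinarith [mul_nonneg h0 (sub_nonneg.2 h₁₁), mul_nonneg (sub_nonneg.2 hp) (sub_nonneg.2 h₁₀),
    mul_nonneg (sub_nonneg.2 h1) (sub_nonneg.2 h₀₀)]

lemma Dom.mean_le {n : ℕ} {t t' : BitTree} (h : Dom n t t') :
    0 ≤ mean t' ∧ mean t' ≤ mean t ∧ mean t ≤ 1 := by
  induction h with
  | ofLeaf ha hb hab =>
    simp only [mean]
    rcases ha with rfl | rfl <;> rcases hb with rfl | rfl <;> simp_all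
  | @ofNode n p p' t₁ t₀ t₁' t₀' h0 hp h1 _ _ _ i₁₁ i₁₀ i₀₀ =>
    simp only [mean]
    refine ⟨?_, mix_mono h0 hp h1 i₁₁.2.1 i₁₀.2.1 i₀₀.2.1, ?_⟩
    · have := mul_nonneg h0 i₁₁.1
      have := mul_nonneg (by linarith : (0 : ℝ) ≤ 1 - p') i₁₀.1
      linarith
    · have := mul_le_mul_of_nonneg_left i₁₁.2.2 (h0.trans hp)
      have := mul_le_mul_of_nonneg_left i₀₀.2.2 (by linarith : (0 : ℝ) ≤ 1 - p)
      linarith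

lemma Dom.level_mono {F : ℝ → ℝ → ℝ → ℝ}
    (hF : ∀ {p p' a b a' b' : ℝ}, p' ≤ p → a' ≤ a → b' ≤ b → F p' a' b' ≤ F p a b)
    {n : ℕ} {t t' : BitTree} (h : Dom n t t') (k : ℕ) : level F t' k ≤ level F t k := by
  induction h generalizing k with
  | ofLeaf => simp [level]
  | ofNode h0 hp h1 h₁₁ h₁₀ h₀₀ i₁₁ i₁₀ i₀₀ =>
    cases k with
    | zero => exact hF hp h₁₁.mean_le.2.1 h₀₀.mean_le.2.1
    | succ k => exact mix_mono h0 hp h1 (i₁₁ k) (i₁₀ k) (i₀₀ k)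

lemma level_sub (F G : ℝ → ℝ → ℝ → ℝ) (t : BitTree) (k : ℕ) :
    level (fun p a b => F p a b - G p a b) t k = level F t k - level G t k := by
  induction t generalizing k with
  | leaf => simp [level]
  | node p t₁ t₀ i₁ i₀ =>
    cases k with
    | zero => simp [level]
    | succ k => simp only [level, i₁, i₀]; ring

lemma Dom.level_le_level {F G : ℝ → ℝ → ℝ → ℝ}
    (hFG : ∀ {p a b : ℝ}, 0 ≤ p → p ≤ 1 → 0 ≤ b → b ≤ a → a ≤ 1 → F p a b ≤ G p a b)
    {n : ℕ} {t : BitTree} (h : Dom n t t) (k : ℕ) : level F t k ≤ level G t k := by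
  induction t generalizing n k with
  | leaf => simp [level]
  | node p t₁ t₀ i₁ i₀ =>
    cases h with
    | ofNode h0 hp h1 h₁₁ h₁₀ h₀₀ =>
      cases k with
      | zero => exact hFG h0 h1 h₁₀.mean_le.1 h₁₀.mean_le.2.1 h₁₀.mean_le.2.2
      | succ k =>
        have := mul_le_mul_of_nonneg_left (i₁ h₁₁ k) h0
        have := mul_le_mul_of_nonneg_left (i₀ h₀₀ k) (sub_nonneg.2 h1)
        simp only [level]
        linarith

lemma level_zero (t : BitTree) (k : ℕ) : level (fun _ _ _ => 0) t k = 0 := by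
  induction t generalizing k with
  | leaf => simp [level]
  | node p t₁ t₀ i₁ i₀ => cases k <;> simp [level, i₁, i₀]

lemma Dom.incSq_nonneg {n : ℕ} {t : BitTree} (h : Dom n t t) (k : ℕ) : 0 ≤ incSq t k := by
  rw [← level_zero t k]
  refine h.level_le_level (fun h0 h1 _ _ _ => ?_) k
  have := sub_nonneg.2 h1
  positivity

lemma Dom.influence_nonneg {n : ℕ} {t : BitTree} (h : Dom n t t) (k : ℕ) :
    0 ≤ influence t k := by
  rw [← level_zero t k]
  exact h.level_le_level (fun _ _ _ hab _ => sub_nonneg.2 hab) k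

lemma Dom.incSq_le_influence {n : ℕ} {t : BitTree} (h : Dom n t t) (k : ℕ) :
    incSq t k ≤ influence t k := by
  refine h.level_le_level (fun {p a b} h0 h1 hb hab ha => ?_) k
  have h2 : p * (1 - p) ≤ 1 := by nlinarith
  have h3 : (a - b) ^ 2 ≤ a - b := by nlinarith
  calc p * (1 - p) * (a - b) ^ 2 ≤ 1 * (a - b) ^ 2 :=
        mul_le_mul_of_nonneg_right h2 (sq_nonneg _)
    _ ≤ a - b := by linarith

/-- Harris' inequality for the bit of depth `k` and an observable increasing in the earlier bits. -/
lemma Dom.harris {F : ℝ → ℝ → ℝ → ℝ}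
    (hF : ∀ {p p' a b a' b' : ℝ}, p' ≤ p → a' ≤ a → b' ≤ b → F p' a' b' ≤ F p a b)
    {n : ℕ} {t : BitTree} (h : Dom n t t) (k : ℕ) :
    level F t k * level (fun p _ _ => p) t k ≤ level (fun p a b => p * F p a b) t k := by
  induction t generalizing n k with
  | leaf => simp [level]
  | node p t₁ t₀ i₁ i₀ =>
    cases h with
    | ofNode h0 hp h1 h₁₁ h₁₀ h₀₀ =>
      cases k with
      | zero => simp [level, mul_comm]
      | succ k =>
        have e₁ := mul_le_mul_of_nonneg_left (i₁ h₁₁ k) h0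
        have e₀ := mul_le_mul_of_nonneg_left (i₀ h₀₀ k) (sub_nonneg.2 h1)
        have e := mul_nonneg (mul_nonneg h0 (sub_nonneg.2 h1)) (mul_nonneg
          (sub_nonneg.2 (h₁₀.level_mono hF k))
          (sub_nonneg.2 (h₁₀.level_mono (F := fun p _ _ => p) (fun hp _ _ => hp) k)))
        simp only [level]
        nlinarith

lemma Dom.sum_incSq {n : ℕ} {t : BitTree} (h : Dom n t t) :
    ∑ k ∈ Finset.range n, incSq t k = mean t * (1 - mean t) := by
  induction t generalizing n with
  | leaf a =>
    cases h with
    | ofLeaf ha => rcases ha with rfl | rfl <;> simp [mean]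
  | node p t₁ t₀ i₁ i₀ =>
    cases h with
    | ofNode h0 hp h1 h₁₁ h₁₀ h₀₀ =>
      rw [Finset.sum_range_succ']
      have e₁ := i₁ h₁₁
      have e₀ := i₀ h₀₀
      simp only [incSq, level, mean, Finset.sum_add_distrib, ← Finset.mul_sum] at e₁ e₀ ⊢
      rw [e₁, e₀]
      ring

lemma coupling_cauchy_schwarz {p p' x₁ x₀ y₁ y₀ X Y : ℝ} (h0 : 0 ≤ p') (hp : p' ≤ p) (h1 : p ≤ 1)
    (hX : X = p * x₁ ^ 2 + (1 - p) * x₀ ^ 2) (hY : Y = p' * y₁ ^ 2 + (1 - p') * y₀ ^ 2) :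
    p' * (x₁ * y₁) + (p - p') * (x₁ * y₀) + (1 - p) * (x₀ * y₀) ≤ √X * √Y := by
  have hX0 : 0 ≤ X := by
    have := sub_nonneg.2 h1
    have := h0.trans hp
    rw [hX]; positivity
  rw [← Real.sqrt_mul hX0]
  refine Real.le_sqrt_of_sq_le ?_
  rw [hX, hY]
  have a := mul_nonneg (mul_nonneg h0 (sub_nonneg.2 hp)) (sq_nonneg (x₁ * y₀ - x₁ * y₁))
  have b := mul_nonneg (mul_nonneg h0 (sub_nonneg.2 h1)) (sq_nonneg (x₁ * y₀ - x₀ * y₁))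
  have c := mul_nonneg (mul_nonneg (sub_nonneg.2 hp) (sub_nonneg.2 h1))
    (sq_nonneg (x₁ * y₀ - x₀ * y₀))
  nlinarith

/-- In the monotone coupling the product of the two `{0, 1}`-valued observables is the smaller one,
and the Cauchy-Schwarz inequality is applied to each martingale increment. -/
lemma Dom.mean_le_sum_sqrt {n : ℕ} {t t' : BitTree} (h : Dom n t t') (hs : Dom n t t)
    (hs' : Dom n t' t') :
    mean t' ≤ mean t * mean t' + ∑ k ∈ Finset.range n, √(incSq t k) * √(incSq t' k) := by
  induction h with
  | ofLeaf ha hb hab =>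
    simp only [mean]
    rcases ha with rfl | rfl <;> rcases hb with rfl | rfl <;> simp_all
  | @ofNode n p p' t₁ t₀ t₁' t₀' h0 hp h1 h₁₁ h₁₀ h₀₀ i₁₁ i₁₀ i₀₀ =>
    cases hs with
    | ofNode _ _ _ s₁₁ s₁₀ s₀₀ =>
    cases hs' with
    | ofNode _ _ _ s₁₁' s₁₀' s₀₀' =>
    have j₁₁ := mul_le_mul_of_nonneg_left (i₁₁ s₁₁ s₁₁') h0
    have j₁₀ := mul_le_mul_of_nonneg_left (i₁₀ s₁₁ s₀₀') (sub_nonneg.2 hp)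
    have j₀₀ := mul_le_mul_of_nonneg_left (i₀₀ s₀₀ s₀₀') (sub_nonneg.2 h1)
    rw [Finset.sum_range_succ']
    have first : p' * (mean t₁ * mean t₁') + (p - p') * (mean t₁ * mean t₀')
        + (1 - p) * (mean t₀ * mean t₀')
        - (p * mean t₁ + (1 - p) * mean t₀) * (p' * mean t₁' + (1 - p') * mean t₀')
        ≤ √(incSq (node p t₁ t₀) 0) * √(incSq (node p' t₁' t₀') 0) := by
      have := coupling_cauchy_schwarz (X := incSq (node p t₁ t₀) 0)
        (Y := incSq (node p' t₁' t₀') 0)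
        (x₁ := (1 - p) * (mean t₁ - mean t₀)) (x₀ := - p * (mean t₁ - mean t₀))
        (y₁ := (1 - p') * (mean t₁' - mean t₀')) (y₀ := - p' * (mean t₁' - mean t₀'))
        h0 hp h1 (by simp only [incSq, level]; ring) (by simp only [incSq, level]; ring)
      refine le_trans (le_of_eq ?_) this
      ring
    have rest : p' * ∑ k ∈ Finset.range n, √(incSq t₁ k) * √(incSq t₁' k)
        + (p - p') * ∑ k ∈ Finset.range n, √(incSq t₁ k) * √(incSq t₀' k)
        + (1 - p) * ∑ k ∈ Finset.range n, √(incSq t₀ k) * √(incSq t₀' k)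
        ≤ ∑ k ∈ Finset.range n,
          √(incSq (node p t₁ t₀) (k + 1)) * √(incSq (node p' t₁' t₀') (k + 1)) := by
      simp only [Finset.mul_sum, ← Finset.sum_add_distrib]
      refine Finset.sum_le_sum fun k _ => coupling_cauchy_schwarz h0 hp h1 ?_ ?_
      · rw [Real.sq_sqrt (s₁₁.incSq_nonneg k), Real.sq_sqrt (s₀₀.incSq_nonneg k)]
        rfl
      · rw [Real.sq_sqrt (s₁₁'.incSq_nonneg k), Real.sq_sqrt (s₀₀'.incSq_nonneg k)]
        rfl
    simp only [mean]
    nlinarith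

lemma mul_log_div_lower {x y c : ℝ} (hx : 0 ≤ x) (hxy : x ≤ y) (hc : 0 < c) :
    x * Real.log c⁻¹ + x - y / c ≤ x * Real.log x - x * Real.log y := by
  rcases hx.eq_or_lt with rfl | hx
  · have := div_nonneg hxy hc.le
    simpa using this
  · have hy : 0 < y := hx.trans_le hxy
    have h1 := Real.log_le_sub_one_of_pos (x := y / (c * x)) (by positivity)
    rw [Real.log_div hy.ne' (by positivity), Real.log_mul hc.ne' hx.ne'] at h1
    have h2 := mul_le_mul_of_nonneg_left h1 hx.le
    have h3 : x * (y / (c * x) - 1) = y / c - x := by field_simp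
    rw [Real.log_inv]
    linarith

lemma mix_pos_or {p x₁ x₀ : ℝ} (h0 : 0 ≤ p) (h1 : p ≤ 1) (hx₁ : 0 ≤ x₁) (hx₀ : 0 ≤ x₀) :
    0 ≤ p * x₁ + (1 - p) * x₀ := by
  have := sub_nonneg.2 h1
  positivity

/-- Joint convexity of relative entropy for a two-point mixture. -/
lemma relEntropy_mix_le {p x₁ x₀ y₁ y₀ : ℝ} (h0 : 0 ≤ p) (h1 : p ≤ 1) (hx₁ : 0 ≤ x₁)
    (hx₀ : 0 ≤ x₀) (h₁ : x₁ ≤ y₁) (h₀ : x₀ ≤ y₀) :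
    (p * x₁ + (1 - p) * x₀) * Real.log (p * x₁ + (1 - p) * x₀)
        - (p * x₁ + (1 - p) * x₀) * Real.log (p * y₁ + (1 - p) * y₀)
      ≤ p * (x₁ * Real.log x₁ - x₁ * Real.log y₁)
        + (1 - p) * (x₀ * Real.log x₀ - x₀ * Real.log y₀) := by
  have hx := mix_pos_or h0 h1 hx₁ hx₀
  have hxy : p * x₁ + (1 - p) * x₀ ≤ p * y₁ + (1 - p) * y₀ := by
    have := mul_le_mul_of_nonneg_left h₁ h0
    have := mul_le_mul_of_nonneg_left h₀ (sub_nonneg.2 h1)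
    linarith
  have key : ∀ c : ℝ, 0 < c → (p * x₁ + (1 - p) * x₀) * Real.log c⁻¹ + (p * x₁ + (1 - p) * x₀)
      - (p * y₁ + (1 - p) * y₀) / c ≤ p * (x₁ * Real.log x₁ - x₁ * Real.log y₁)
        + (1 - p) * (x₀ * Real.log x₀ - x₀ * Real.log y₀) := fun c hc => by
    have e₁ := mul_le_mul_of_nonneg_left (mul_log_div_lower hx₁ h₁ hc) h0
    have e₀ := mul_le_mul_of_nonneg_left (mul_log_div_lower hx₀ h₀ hc) (sub_nonneg.2 h1)
    have : (p * y₁ + (1 - p) * y₀) / c = p * (y₁ / c) + (1 - p) * (y₀ / c) := by ring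
    linarith
  rcases hx.eq_or_lt with h | h
  · have e₁ : p * x₁ = 0 := by nlinarith [mul_nonneg h0 hx₁, mul_nonneg (sub_nonneg.2 h1) hx₀]
    have e₀ : (1 - p) * x₀ = 0 := by linarith
    rw [← h, mul_sub, mul_sub, ← mul_assoc, ← mul_assoc, ← mul_assoc, ← mul_assoc, e₁, e₀]
    simp
  · have hy := h.trans_le hxy
    have := key _ (div_pos hy h)
    rw [inv_div, Real.log_div h.ne' hy.ne', div_div_eq_mul_div,
      mul_div_cancel_left₀ _ hy.ne'] at this
    linarith

/-- The entropy of the square of a two-valued function is at most the square of its oscillation,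
whatever the bias. -/
lemma entropy_mix_le {p x₁ x₀ : ℝ} (h0 : 0 ≤ p) (h1 : p ≤ 1) (hx₁ : 0 ≤ x₁) (hx₀ : 0 ≤ x₀) :
    p * (x₁ * Real.log x₁) + (1 - p) * (x₀ * Real.log x₀)
        - (p * x₁ + (1 - p) * x₀) * Real.log (p * x₁ + (1 - p) * x₀)
      ≤ (√x₁ - √x₀) ^ 2 := by
  have hx := mix_pos_or h0 h1 hx₁ hx₀
  set s := p * x₁ + (1 - p) * x₀ with hs
  rcases hx.eq_or_lt with h | h
  · have e₁ : p * x₁ = 0 := by nlinarith [mul_nonneg h0 hx₁, mul_nonneg (sub_nonneg.2 h1) hx₀]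
    have e₀ : (1 - p) * x₀ = 0 := by linarith
    rw [← h, ← mul_assoc, ← mul_assoc, e₁, e₀]
    simpa using sq_nonneg _
  have key : ∀ x : ℝ, 0 ≤ x → x * Real.log x ≤ x * Real.log s + x * (x / s - 1) := fun x hx => by
    rcases hx.eq_or_lt with rfl | hx
    · simp
    have h1 := Real.log_le_sub_one_of_pos (div_pos hx h)
    rw [Real.log_div hx.ne' h.ne'] at h1
    nlinarith
  have e₁ := mul_le_mul_of_nonneg_left (key x₁ hx₁) h0
  have e₀ := mul_le_mul_of_nonneg_left (key x₀ hx₀) (sub_nonneg.2 h1)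
  have var : p * (x₁ * (x₁ / s - 1)) + (1 - p) * (x₀ * (x₀ / s - 1))
      = p * (1 - p) * (x₁ - x₀) ^ 2 / s := by
    field_simp
    rw [hs]
    ring
  have fin : p * (1 - p) * (x₁ - x₀) ^ 2 / s ≤ (√x₁ - √x₀) ^ 2 := by
    rw [div_le_iff₀ h]
    obtain ⟨a, ha, rfl⟩ : ∃ a, 0 ≤ a ∧ x₁ = a ^ 2 := ⟨√x₁, by positivity, (Real.sq_sqrt hx₁).symm⟩
    obtain ⟨b, hb, rfl⟩ : ∃ b, 0 ≤ b ∧ x₀ = b ^ 2 := ⟨√x₀, by positivity, (Real.sq_sqrt hx₀).symm⟩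
    rw [Real.sqrt_sq ha, Real.sqrt_sq hb, hs]
    have : 0 ≤ (a - b) ^ 2 * (p * a - (1 - p) * b) ^ 2 := by positivity
    nlinarith
  have : p * (x₁ * Real.log s) + (1 - p) * (x₀ * Real.log s) = s * Real.log s := by
    rw [hs]; ring
  linarith

lemma entropy_term_mix_le {p x₁ x₀ y₁ y₀ : ℝ} (h0 : 0 ≤ p) (h1 : p ≤ 1) (hx₁ : 0 ≤ x₁)
    (hx₀ : 0 ≤ x₀) (h₁ : x₁ ≤ y₁) (h₀ : x₀ ≤ y₀) :
    (p * x₁ + (1 - p) * x₀) * (Real.log (p * x₁ + (1 - p) * x₀)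
        - 2 * Real.log (p * y₁ + (1 - p) * y₀))
      ≤ p * (x₁ * (Real.log x₁ - 2 * Real.log y₁))
        + (1 - p) * (x₀ * (Real.log x₀ - 2 * Real.log y₀)) + (√x₁ - √x₀) ^ 2 := by
  have := relEntropy_mix_le h0 h1 hx₁ hx₀ h₁ h₀
  have := entropy_mix_le h0 h1 hx₁ hx₀
  nlinarith

lemma Dom.sum_entropy_le {n : ℕ} {t : BitTree} (h : Dom n t t) :
    ∑ k ∈ Finset.range n, incSq t k * (Real.log (incSq t k) - 2 * Real.log (influence t k))
      ≤ ∑ k ∈ Finset.range n, influence t k := by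
  induction t generalizing n with
  | leaf a => cases h; simp
  | node p t₁ t₀ i₁ i₀ =>
    cases h with
    | @ofNode n _ _ _ _ _ _ h0 hp h1 h₁₁ h₁₀ h₀₀ =>
      rw [Finset.sum_range_succ', Finset.sum_range_succ']
      have q0 := sub_nonneg.2 h1
      have first : incSq (node p t₁ t₀) 0 * (Real.log (incSq (node p t₁ t₀) 0)
          - 2 * Real.log (influence (node p t₁ t₀) 0)) ≤ 0 := by
        simp only [incSq, influence, level]
        rcases eq_or_ne (p * (1 - p) * (mean t₁ - mean t₀) ^ 2) 0 with e | e
        · rw [e]; simp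
        · have e1 : p * (1 - p) ≠ 0 := fun h => e (by rw [h, zero_mul])
          have e2 : (mean t₁ - mean t₀) ^ 2 ≠ 0 := fun h => e (by rw [h, mul_zero])
          rw [Real.log_mul e1 e2, Real.log_pow]
          have : Real.log (p * (1 - p)) ≤ 0 :=
            Real.log_nonpos (mul_nonneg h0 q0) (by nlinarith)
          refine mul_nonpos_of_nonneg_of_nonpos (by positivity) ?_
          push_cast
          linarith
      have rest : ∑ k ∈ Finset.range n, incSq (node p t₁ t₀) (k + 1)
            * (Real.log (incSq (node p t₁ t₀) (k + 1))
              - 2 * Real.log (influence (node p t₁ t₀) (k + 1)))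
          ≤ p * ∑ k ∈ Finset.range n, incSq t₁ k
              * (Real.log (incSq t₁ k) - 2 * Real.log (influence t₁ k))
            + (1 - p) * ∑ k ∈ Finset.range n, incSq t₀ k
              * (Real.log (incSq t₀ k) - 2 * Real.log (influence t₀ k))
            + ∑ k ∈ Finset.range n, (√(incSq t₁ k) - √(incSq t₀ k)) ^ 2 := by
        simp only [Finset.mul_sum, ← Finset.sum_add_distrib]
        exact Finset.sum_le_sum fun k _ => entropy_term_mix_le h0 h1 (h₁₁.incSq_nonneg k)
          (h₀₀.incSq_nonneg k) (h₁₁.incSq_le_influence k) (h₀₀.incSq_le_influence k)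
      have osc : ∑ k ∈ Finset.range n, (√(incSq t₁ k) - √(incSq t₀ k)) ^ 2
          ≤ mean t₁ - mean t₀ := by
        have e : ∑ k ∈ Finset.range n, (√(incSq t₁ k) - √(incSq t₀ k)) ^ 2
            = ∑ k ∈ Finset.range n, incSq t₁ k + ∑ k ∈ Finset.range n, incSq t₀ k
              - 2 * ∑ k ∈ Finset.range n, √(incSq t₁ k) * √(incSq t₀ k) := by
          rw [Finset.mul_sum, ← Finset.sum_add_distrib, ← Finset.sum_sub_distrib]
          refine Finset.sum_congr rfl fun k _ => ?_
          rw [sub_sq, Real.sq_sqrt (h₁₁.incSq_nonneg k), Real.sq_sqrt (h₀₀.incSq_nonneg k)]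
          ring
        rw [e, h₁₁.sum_incSq, h₀₀.sum_incSq]
        nlinarith [h₁₀.mean_le_sum_sqrt h₁₁ h₀₀, sq_nonneg (mean t₁ - mean t₀)]
      have split : ∑ k ∈ Finset.range n, influence (node p t₁ t₀) (k + 1)
          = p * ∑ k ∈ Finset.range n, influence t₁ k
            + (1 - p) * ∑ k ∈ Finset.range n, influence t₀ k := by
        simp only [influence, level, Finset.mul_sum, Finset.sum_add_distrib]
      have zero : influence (node p t₁ t₀) 0 = mean t₁ - mean t₀ := rfl
      have := mul_le_mul_of_nonneg_left (i₁ h₁₁) h0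
      have := mul_le_mul_of_nonneg_left (i₀ h₀₀) q0
      linarith

/-- Talagrand-type inequality for a monotone tree all of whose influences are at most `m`. -/
lemma Dom.variance_mul_log_le {n : ℕ} {t : BitTree} (h : Dom n t t) {m : ℝ} (hm : 0 < m)
    (hle : ∀ k < n, influence t k ≤ m) :
    mean t * (1 - mean t) * Real.log (1 / (2 * m)) ≤ 4 * ∑ k ∈ Finset.range n, influence t k := by
  have hS0 : 0 ≤ ∑ k ∈ Finset.range n, influence t k :=
    Finset.sum_nonneg fun k _ => h.influence_nonneg k
  have hvS : mean t * (1 - mean t) ≤ ∑ k ∈ Finset.range n, influence t k := by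
    rw [← h.sum_incSq]
    exact Finset.sum_le_sum fun k _ => h.incSq_le_influence k
  have hv0 : 0 ≤ mean t * (1 - mean t) := by
    rw [← h.sum_incSq]
    exact Finset.sum_nonneg fun k _ => h.incSq_nonneg k
  have hent := h.sum_entropy_le
  have hsum := h.sum_incSq
  set v := mean t * (1 - mean t)
  set S := ∑ k ∈ Finset.range n, influence t k with hS
  set L := Real.log (1 / (2 * m)) with hL
  rcases hv0.eq_or_lt with hv | hv
  · rw [← hv]; linarith
  rcases le_or_gt L 0 with hL0 | hL0
  · nlinarith
  have hSpos : 0 < S := hv.trans_le hvS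
  have low : v * (Real.log v - Real.log S - Real.log m) ≤ S := by
    refine le_trans ?_ hent
    have hterm : ∀ k ∈ Finset.range n,
        incSq t k * Real.log (S / v)⁻¹ + incSq t k - influence t k / (S / v)
            - incSq t k * Real.log m
          ≤ incSq t k * (Real.log (incSq t k) - 2 * Real.log (influence t k)) := fun k hk => by
      have e := mul_log_div_lower (h.incSq_nonneg k) (h.incSq_le_influence k) (div_pos hSpos hv)
      rcases (h.incSq_nonneg k).eq_or_lt with h0 | h0
      · rw [← h0] at e ⊢
        linarith
      · have := Real.log_le_log (h0.trans_le (h.incSq_le_influence k))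
          (hle k (Finset.mem_range.1 hk))
        nlinarith
    refine le_trans (le_of_eq ?_) (Finset.sum_le_sum hterm)
    rw [Finset.sum_sub_distrib, Finset.sum_sub_distrib, Finset.sum_add_distrib,
      ← Finset.sum_mul, ← Finset.sum_mul, ← Finset.sum_div, hsum, ← hS, inv_div,
      Real.log_div hv.ne' hSpos.ne']
    field_simp
    ring
  by_contra! hcon
  have hlogL : Real.log L ≤ L / 2 := by
    have : L / 2 + 1 ≤ Real.exp (L / 2) := Real.add_one_le_exp _
    have h4 : Real.log (L / 2) ≤ L / 2 - 1 := Real.log_le_sub_one_of_pos (by positivity)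
    rw [Real.log_div hL0.ne' two_ne_zero] at h4
    have := Real.log_two_lt_d9
    linarith
  have hm' : Real.log m = - L - Real.log 2 := by
    rw [hL, one_div, Real.log_inv, Real.log_mul two_ne_zero hm.ne']
    ring
  have hlogS : Real.log S ≤ Real.log v + Real.log L - 2 * Real.log 2 := by
    have h5 : Real.log S ≤ Real.log (v * L / 4) := Real.log_le_log hSpos (by linarith)
    rw [Real.log_div (by positivity) (by norm_num), Real.log_mul hv.ne' hL0.ne',
      show (4 : ℝ) = 2 ^ 2 by norm_num, Real.log_pow] at h5
    push_cast at h5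
    linarith
  have := Real.log_pos one_lt_two
  have : v * (L / 2) ≤ v * (Real.log v - Real.log S - Real.log m) :=
    mul_le_mul_of_nonneg_left (by linarith) hv.le
  nlinarith

end BitTree

/-! ### The four functions theorem on `ℝ^K` -/

section FourFunctions

open scoped ENNReal

lemma ENNReal.add_le_add_of_mul_le_mul {a b c d : ℝ≥0∞} (ha : a ≤ c) (hb : b ≤ c)
    (h : a * b ≤ c * d) : a + b ≤ c + d := by
  rcases eq_or_ne c ∞ with rfl | hc
  · simp
  rcases eq_or_ne d ∞ with rfl | hd
  · simp
  lift c to NNReal using hc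
  lift d to NNReal using hd
  lift a to NNReal using ne_top_of_le_ne_top ENNReal.coe_ne_top ha
  lift b to NNReal using ne_top_of_le_ne_top ENNReal.coe_ne_top hb
  norm_cast at *
  rw [← NNReal.coe_le_coe] at *
  push_cast at *
  rcases c.2.eq_or_lt with h0 | h0
  · have : (c : ℝ) = 0 := h0.symm
    have := d.coe_nonneg
    linarith
  · have h0 : (0 : ℝ) < c := h0
    nlinarith [mul_nonneg (sub_nonneg.2 ha) (sub_nonneg.2 hb)]

/-- The four functions theorem on the real line. -/
lemma lintegral_mul_lintegral_le_of_sup_inf {α β γ δ : ℝ → ℝ≥0∞} (hα : Measurable α)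
    (hβ : Measurable β) (hγ : Measurable γ) (hδ : Measurable δ)
    (h : ∀ s t, α s * β t ≤ γ (s ⊔ t) * δ (s ⊓ t)) (μ : Measure ℝ) [SFinite μ] :
    (∫⁻ t, α t ∂μ) * ∫⁻ t, β t ∂μ ≤ (∫⁻ t, γ t ∂μ) * ∫⁻ t, δ t ∂μ := by
  have key : ∀ s t, α s * β t + β s * α t ≤ γ s * δ t + δ s * γ t := by
    have aux : ∀ s t, s ≤ t → α s * β t + α t * β s ≤ γ t * δ s + γ s * δ t := fun s t hst => by
      refine ENNReal.add_le_add_of_mul_le_mul ?_ ?_ ?_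
      · simpa [hst] using h s t
      · simpa [hst] using h t s
      · calc α s * β t * (α t * β s) = (α s * β s) * (α t * β t) := by ring
          _ ≤ (γ s * δ s) * (γ t * δ t) :=
            mul_le_mul' (by simpa using h s s) (by simpa using h t t)
          _ = _ := by ring
    intro s t
    rcases le_total s t with hst | hst
    · calc _ = α s * β t + α t * β s := by ring
        _ ≤ _ := aux s t hst
        _ = _ := by ring
    · calc _ = α t * β s + α s * β t := by ring
        _ ≤ _ := aux t s hst
        _ = _ := by ring
  have double : ∀ f g : ℝ → ℝ≥0∞, Measurable f → Measurable g →
      ∫⁻ s, ∫⁻ t, (f s * g t + g s * f t) ∂μ ∂μ = 2 * ((∫⁻ t, f t ∂μ) * ∫⁻ t, g t ∂μ) := by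
    intro f g hf hg
    have : ∀ s, ∫⁻ t, (f s * g t + g s * f t) ∂μ
        = f s * ∫⁻ t, g t ∂μ + g s * ∫⁻ t, f t ∂μ := fun s => by
      rw [lintegral_add_left (by fun_prop), lintegral_const_mul _ hg, lintegral_const_mul _ hf]
    simp_rw [this]
    rw [lintegral_add_left (by fun_prop), lintegral_mul_const _ hf, lintegral_mul_const _ hg]
    ring
  have := lintegral_mono (μ := μ) fun s => lintegral_mono (μ := μ) fun t => key s t
  rw [double α β hα hβ, double γ δ hγ hδ] at this
  exact (ENNReal.mul_le_mul_iff_right two_ne_zero ENNReal.ofNat_ne_top).1 this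

/-- The four functions theorem for Lebesgue measure on `ℝ^K`. -/
lemma lintegral_pi_mul_le_of_sup_inf {K : Type*} [Fintype K] {α β γ δ : (K → ℝ) → ℝ≥0∞}
    (hα : Measurable α) (hβ : Measurable β) (hγ : Measurable γ) (hδ : Measurable δ)
    (h : ∀ φ ψ, α φ * β ψ ≤ γ (φ ⊔ ψ) * δ (φ ⊓ ψ)) :
    (∫⁻ φ, α φ) * ∫⁻ φ, β φ ≤ (∫⁻ φ, γ φ) * ∫⁻ φ, δ φ := by
  classical
  let ν : K → Measure ℝ := fun _ => volume
  have key : ∀ s : Finset K, ∀ φ ψ, (∫⋯∫⁻_s, α ∂ν) φ * (∫⋯∫⁻_s, β ∂ν) ψ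
      ≤ (∫⋯∫⁻_s, γ ∂ν) (φ ⊔ ψ) * (∫⋯∫⁻_s, δ ∂ν) (φ ⊓ ψ) := by
    intro s
    induction s using Finset.induction_on with
    | empty => simpa using h
    | insert i s hi ih =>
      intro φ ψ
      rw [lmarginal_insert _ hα hi, lmarginal_insert _ hβ hi, lmarginal_insert _ hγ hi,
        lmarginal_insert _ hδ hi]
      have upd : ∀ (f : (K → ℝ) → ℝ≥0∞) (x : K → ℝ), Measurable f →
          Measurable fun t => (∫⋯∫⁻_s, f ∂ν) (Function.update x i t) := fun f x hf =>
        (hf.lmarginal ν).comp (measurable_update x)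
      refine lintegral_mul_lintegral_le_of_sup_inf (upd α φ hα) (upd β ψ hβ) (upd γ _ hγ)
        (upd δ _ hδ) (fun a b => ?_) _
      convert ih (Function.update φ i a) (Function.update ψ i b) using 3
      · ext j
        rcases eq_or_ne j i with rfl | hj <;> simp [*]
      · ext j
        rcases eq_or_ne j i with rfl | hj <;> simp [*]
  have := key Finset.univ 0 0
  simpa [ν, lmarginal_univ, ← volume_pi] using this

/-- The four functions theorem for a measure with log-supermodular density. -/
lemma lintegral_withDensity_mul_le_of_sup_inf {K : Type*} [Fintype K] {ρ : (K → ℝ) → ℝ≥0∞}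
    (hρ : Measurable ρ) (hsup : ∀ φ ψ, ρ φ * ρ ψ ≤ ρ (φ ⊔ ψ) * ρ (φ ⊓ ψ))
    {α β γ δ : (K → ℝ) → ℝ≥0∞} (hα : Measurable α) (hβ : Measurable β) (hγ : Measurable γ)
    (hδ : Measurable δ) (h : ∀ φ ψ, α φ * β ψ ≤ γ (φ ⊔ ψ) * δ (φ ⊓ ψ)) :
    (∫⁻ φ, α φ ∂(volume.withDensity ρ)) * ∫⁻ φ, β φ ∂(volume.withDensity ρ)
      ≤ (∫⁻ φ, γ φ ∂(volume.withDensity ρ)) * ∫⁻ φ, δ φ ∂(volume.withDensity ρ) := by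
  rw [lintegral_withDensity_eq_lintegral_mul _ hρ hα,
    lintegral_withDensity_eq_lintegral_mul _ hρ hβ,
    lintegral_withDensity_eq_lintegral_mul _ hρ hγ, lintegral_withDensity_eq_lintegral_mul _ hρ hδ]
  refine lintegral_pi_mul_le_of_sup_inf (hρ.mul hα) (hρ.mul hβ) (hρ.mul hγ) (hρ.mul hδ)
    fun φ ψ => ?_
  calc ρ φ * α φ * (ρ ψ * β ψ) = (ρ φ * ρ ψ) * (α φ * β ψ) := by ring
    _ ≤ (ρ (φ ⊔ ψ) * ρ (φ ⊓ ψ)) * (γ (φ ⊔ ψ) * δ (φ ⊓ ψ)) := mul_le_mul' (hsup φ ψ) (h φ ψ)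
    _ = ρ (φ ⊔ ψ) * γ (φ ⊔ ψ) * (ρ (φ ⊓ ψ) * δ (φ ⊓ ψ)) := by ring

end FourFunctions

/-! ### Influences for measures on the cube satisfying the lattice condition -/

section Cube

variable {K : Type*}

/-- Configurations agreeing with `ω` outside of `l`. -/
def agreeOff (l : List K) (ω : K → Bool) : Set (K → Bool) := {η | ∀ x ∉ l, η x = ω x}

lemma agreeOff_congr {l : List K} {ω ω' : K → Bool} (h : ∀ x ∉ l, ω x = ω' x) :
    agreeOff l ω = agreeOff l ω' := by
  ext η
  exact forall₂_congr fun x hx => by rw [h x hx]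

lemma agreeOff_nil (ω : K → Bool) : agreeOff [] ω = {ω} := by
  ext η
  simp [agreeOff, funext_iff]

lemma sum_range_le_sum_map {l : List K} {J : ℕ → ℝ} {g : K → ℝ}
    (h : ∀ k x, l[k]? = some x → J k ≤ g x) :
    ∑ k ∈ Finset.range l.length, J k ≤ (l.map g).sum := by
  induction l generalizing J with
  | nil => simp
  | cons x l ih =>
    rw [List.length_cons, Finset.sum_range_succ', List.map_cons, List.sum_cons, add_comm]
    exact add_le_add (h 0 x (by simp)) (ih fun k y hk => h (k + 1) y (by simpa using hk))

variable [DecidableEq K]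

lemma agreeOff_cons_inter {x : K} {l : List K} (hx : x ∉ l) (ω : K → Bool) (b : Bool) :
    agreeOff (x :: l) ω ∩ {η | η x = b} = agreeOff l (Function.update ω x b) := by
  ext η
  constructor
  · rintro ⟨h, hb⟩ y hy
    rcases eq_or_ne y x with rfl | hyx
    · simpa using hb
    · simpa [hyx] using h y (by simp [hy, hyx])
  · intro h
    refine ⟨fun y hy => ?_, by simpa using h x hx⟩
    rw [List.mem_cons, not_or] at hy
    simpa [hy.1] using h y hy.2

variable [Fintype K] (ν : Measure (K → Bool))

lemma measureReal_inter_agreeOff_cons [IsFiniteMeasure ν] {x : K} {l : List K} (hx : x ∉ l)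
    (ω : K → Bool) (S : Set (K → Bool)) :
    ν.real (S ∩ agreeOff (x :: l) ω) = ν.real (S ∩ agreeOff l (Function.update ω x true))
      + ν.real (S ∩ agreeOff l (Function.update ω x false)) := by
  rw [← agreeOff_cons_inter hx, ← agreeOff_cons_inter hx, ← Set.inter_assoc, ← Set.inter_assoc,
    ← measureReal_inter_add_sdiff (s := S ∩ agreeOff (x :: l) ω)
      (MeasurableSet.of_discrete (s := {η : K → Bool | η x = true}))]
  congr 2
  ext η
  simp

/-- The tree obtained by revealing the bits of `l` one after the other, given that the
configuration agrees with `ω` outside of `l`. -/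
noncomputable def revealTree (A : Set (K → Bool)) : List K → (K → Bool) → BitTree
  | [], ω => .leaf (A.indicator (fun _ => 1) ω)
  | x :: l, ω => .node
      (ν.real (agreeOff l (Function.update ω x true)) / ν.real (agreeOff (x :: l) ω))
      (revealTree A l (Function.update ω x true)) (revealTree A l (Function.update ω x false))

variable {ν} {A : Set (K → Bool)}

lemma revealTree_mix [IsFiniteMeasure ν] (hpos : ∀ l ω, 0 < ν.real (agreeOff l ω)) {x : K}
    {l : List K} (hx : x ∉ l) (ω : K → Bool) (a b : ℝ) :
    (ν.real (agreeOff l (Function.update ω x true)) / ν.real (agreeOff (x :: l) ω) * a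
      + (1 - ν.real (agreeOff l (Function.update ω x true)) / ν.real (agreeOff (x :: l) ω)) * b)
        * ν.real (agreeOff (x :: l) ω)
      = a * ν.real (agreeOff l (Function.update ω x true))
        + b * ν.real (agreeOff l (Function.update ω x false)) := by
  have h := measureReal_inter_agreeOff_cons ν hx ω Set.univ
  simp only [Set.univ_inter] at h
  have := (hpos (x :: l) ω).ne'
  field_simp
  rw [h]
  ring

lemma mean_revealTree [IsFiniteMeasure ν] (hpos : ∀ l ω, 0 < ν.real (agreeOff l ω))
    {l : List K} (hl : l.Nodup) (ω : K → Bool) :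
    (revealTree ν A l ω).mean * ν.real (agreeOff l ω) = ν.real (A ∩ agreeOff l ω) := by
  induction l generalizing ω with
  | nil =>
    rw [agreeOff_nil]
    by_cases h : ω ∈ A
    · rw [Set.inter_eq_right.2 (Set.singleton_subset_iff.2 h)]
      simp [revealTree, BitTree.mean, h]
    · rw [Set.inter_singleton_eq_empty.2 h]
      simp [revealTree, BitTree.mean, h]
  | cons x l ih =>
    rw [List.nodup_cons] at hl
    rw [revealTree, BitTree.mean, revealTree_mix hpos hl.1, ih hl.2, ih hl.2,
      measureReal_inter_agreeOff_cons ν hl.1]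

lemma level_revealTree [IsFiniteMeasure ν] (hpos : ∀ l ω, 0 < ν.real (agreeOff l ω))
    {F : ℝ → ℝ → ℝ → ℝ} {S : K → Set (K → Bool)}
    (hF : ∀ x l ω, (x :: l).Nodup → (revealTree ν A (x :: l) ω).level F 0
      * ν.real (agreeOff (x :: l) ω) = ν.real (S x ∩ agreeOff (x :: l) ω))
    {l : List K} (hl : l.Nodup) (ω : K → Bool) {k : ℕ} {x : K} (hk : l[k]? = some x) :
    (revealTree ν A l ω).level F k * ν.real (agreeOff l ω) = ν.real (S x ∩ agreeOff l ω) := by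
  induction l generalizing ω k with
  | nil => simp at hk
  | cons y l ih =>
    cases k with
    | zero =>
      obtain rfl : y = x := by simpa using hk
      exact hF y l ω hl
    | succ k =>
      rw [List.nodup_cons] at hl
      have hk : l[k]? = some x := by simpa using hk
      rw [revealTree, BitTree.level, revealTree_mix hpos hl.1, ih hl.2 _ hk, ih hl.2 _ hk,
        measureReal_inter_agreeOff_cons ν hl.1]

lemma level_prob_revealTree [IsFiniteMeasure ν] (hpos : ∀ l ω, 0 < ν.real (agreeOff l ω))
    {l : List K} (hl : l.Nodup) (ω : K → Bool) {k : ℕ} {x : K} (hk : l[k]? = some x) :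
    (revealTree ν A l ω).level (fun p _ _ => p) k * ν.real (agreeOff l ω)
      = ν.real ({η | η x = true} ∩ agreeOff l ω) := by
  refine level_revealTree (S := fun x => {η | η x = true}) hpos (fun x l ω hl => ?_) hl ω hk
  rw [Set.inter_comm, agreeOff_cons_inter (List.nodup_cons.1 hl).1]
  exact div_mul_cancel₀ _ (hpos _ _).ne'

lemma level_true_revealTree [IsFiniteMeasure ν] (hpos : ∀ l ω, 0 < ν.real (agreeOff l ω))
    {l : List K} (hl : l.Nodup) (ω : K → Bool) {k : ℕ} {x : K} (hk : l[k]? = some x) :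
    (revealTree ν A l ω).level (fun p a _ => p * a) k * ν.real (agreeOff l ω)
      = ν.real (A ∩ {η | η x = true} ∩ agreeOff l ω) := by
  refine level_revealTree (S := fun x => A ∩ {η | η x = true}) hpos (fun x l ω hl => ?_) hl ω hk
  rw [List.nodup_cons] at hl
  have := revealTree_mix hpos hl.1 ω (revealTree ν A l (Function.update ω x true)).mean 0
  rw [mul_zero, add_zero, zero_mul, add_zero, mean_revealTree hpos hl.2] at this
  rw [Set.inter_assoc, Set.inter_comm _ (agreeOff (x :: l) ω), agreeOff_cons_inter hl.1]
  exact this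

lemma level_false_revealTree [IsFiniteMeasure ν] (hpos : ∀ l ω, 0 < ν.real (agreeOff l ω))
    {l : List K} (hl : l.Nodup) (ω : K → Bool) {k : ℕ} {x : K} (hk : l[k]? = some x) :
    (revealTree ν A l ω).level (fun p _ b => (1 - p) * b) k * ν.real (agreeOff l ω)
      = ν.real (A ∩ {η | η x = false} ∩ agreeOff l ω) := by
  refine level_revealTree (S := fun x => A ∩ {η | η x = false}) hpos (fun x l ω hl => ?_) hl ω hk
  rw [List.nodup_cons] at hl
  have := revealTree_mix hpos hl.1 ω 0 (revealTree ν A l (Function.update ω x false)).mean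
  rw [mul_zero, zero_add, zero_mul, zero_add, mean_revealTree hpos hl.2] at this
  rw [Set.inter_assoc, Set.inter_comm _ (agreeOff (x :: l) ω), agreeOff_cons_inter hl.1]
  exact this

/-- Under the lattice condition the reveal trees are stochastically monotone. -/
lemma dom_revealTree [IsFiniteMeasure ν] (hpos : ∀ l ω, 0 < ν.real (agreeOff l ω))
    (hlat : ∀ l ω ω', ν.real (agreeOff l ω) * ν.real (agreeOff l ω')
      ≤ ν.real (agreeOff l (ω ⊔ ω')) * ν.real (agreeOff l (ω ⊓ ω')))
    (hA : IsUpperSet A) {l : List K} (hl : l.Nodup) {ω ω' : K → Bool}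
    (h : ∀ x ∉ l, ω' x ≤ ω x) :
    BitTree.Dom l.length (revealTree ν A l ω) (revealTree ν A l ω') := by
  induction l generalizing ω ω' with
  | nil =>
    have hle : ω' ≤ ω := fun x => h x (by simp)
    refine .ofLeaf ?_ ?_ ?_
    · by_cases hω : ω ∈ A <;> simp [hω]
    · by_cases hω : ω' ∈ A <;> simp [hω]
    · by_cases hω : ω' ∈ A
      · simp [hω, hA hle hω]
      · simpa [hω] using Set.indicator_nonneg (fun _ _ => zero_le_one) ω
  | cons x l ih =>
    rw [List.nodup_cons] at hl
    have upd : ∀ b b', b' ≤ b → ∀ y ∉ l, Function.update ω' x b' y ≤ Function.update ω x b y := by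
      intro b b' hb y hy
      rcases eq_or_ne y x with rfl | hyx
      · simpa using hb
      · simpa [hyx] using h y (by simp [hy, hyx])
    have split : ∀ ω, ν.real (agreeOff (x :: l) ω) = ν.real (agreeOff l (Function.update ω x true))
        + ν.real (agreeOff l (Function.update ω x false)) := fun ω => by
      simpa using measureReal_inter_agreeOff_cons ν hl.1 ω Set.univ
    refine .ofNode (by positivity) ?_ ?_ (ih hl.2 (upd _ _ le_rfl)) (ih hl.2 (upd _ _ (by simp)))
      (ih hl.2 (upd _ _ le_rfl))
    · rw [div_le_div_iff₀ (hpos _ _) (hpos _ _), split, split]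
      have := hlat l (Function.update ω' x true) (Function.update ω x false)
      rw [agreeOff_congr (ω := Function.update ω' x true ⊔ Function.update ω x false)
          (ω' := Function.update ω x true),
        agreeOff_congr (ω := Function.update ω' x true ⊓ Function.update ω x false)
          (ω' := Function.update ω' x false)] at this
      · linarith
      · intro y hy
        rcases eq_or_ne y x with rfl | hyx
        · simp
        · simpa [hyx, Bool.le_iff_imp] using h y (by simp [hy, hyx])
      · intro y hy
        rcases eq_or_ne y x with rfl | hyx
        · simp
        · simpa [hyx, Bool.le_iff_imp] using h y (by simp [hy, hyx])
    · rw [div_le_one (hpos _ _), split]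
      linarith [hpos l (Function.update ω x false)]

/-- Influence of the bit at `x` on `A`, conditionally on the value of that bit. -/
noncomputable def bitInfluence (ν : Measure (K → Bool)) (A : Set (K → Bool)) (x : K) : ℝ :=
  ν.real (A ∩ {η | η x = true}) / ν.real {η | η x = true}
    - ν.real (A ∩ {η | η x = false}) / ν.real {η | η x = false}

lemma influence_revealTree_le [IsProbabilityMeasure ν]
    (hpos : ∀ l ω, 0 < ν.real (agreeOff l ω))
    (hlat : ∀ l ω ω', ν.real (agreeOff l ω) * ν.real (agreeOff l ω')
      ≤ ν.real (agreeOff l (ω ⊔ ω')) * ν.real (agreeOff l (ω ⊓ ω')))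
    (hA : IsUpperSet A) {l : List K} (hl : l.Nodup) (hmem : ∀ x, x ∈ l) (ω : K → Bool)
    {k : ℕ} {x : K} (hk : l[k]? = some x) :
    (revealTree ν A l ω).influence k ≤ bitInfluence ν A x := by
  have hcyl : agreeOff l ω = Set.univ := Set.eq_univ_of_forall fun η y hy => absurd (hmem y) hy
  have hD := dom_revealTree hpos hlat hA hl (ω := ω) (ω' := ω) fun _ _ => le_rfl
  have eP := level_prob_revealTree (A := A) hpos hl ω hk
  have e₁ := level_true_revealTree (A := A) hpos hl ω hk
  have e₀ := level_false_revealTree (A := A) hpos hl ω hk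
  have h₁ := hD.harris (F := fun _ a _ => a) (fun _ ha _ => ha) k
  have h₀ := hD.harris (F := fun _ _ b => b) (fun _ _ hb => hb) k
  have hsub := BitTree.level_sub (fun _ _ b => b) (fun p _ b => p * b) (revealTree ν A l ω) k
  simp only [hcyl, Set.inter_univ, probReal_univ, mul_one] at eP e₁ e₀
  have hfun : (fun p _ b : ℝ => b - p * b) = fun p _ b : ℝ => (1 - p) * b := by
    ext p a b; ring
  rw [hfun, e₀] at hsub
  rw [eP] at h₀ h₁
  rw [e₁] at h₁
  have bitPos : ∀ b, 0 < ν.real {η : K → Bool | η x = b} := fun b =>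
    (hpos [] fun _ => b).trans_le (measureReal_mono (by rw [agreeOff_nil]; simp))
  have hcompl : ν.real {η : K → Bool | η x = false} = 1 - ν.real {η : K → Bool | η x = true} := by
    rw [← probReal_compl_eq_one_sub MeasurableSet.of_discrete]
    congr 1
    ext η
    simp
  rw [BitTree.influence, BitTree.level_sub (fun _ a _ => a) (fun _ _ b => b)]
  refine sub_le_sub ((le_div_iff₀ (bitPos _)).2 h₁) ((div_le_iff₀ (bitPos _)).2 ?_)
  rw [hcompl]
  linarith

/-- Talagrand's inequality for increasing events under the lattice condition. -/
theorem variance_mul_log_le_sum_bitInfluence [IsProbabilityMeasure ν]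
    (hpos : ∀ l ω, 0 < ν.real (agreeOff l ω))
    (hlat : ∀ l ω ω', ν.real (agreeOff l ω) * ν.real (agreeOff l ω')
      ≤ ν.real (agreeOff l (ω ⊔ ω')) * ν.real (agreeOff l (ω ⊓ ω')))
    (hA : IsUpperSet A) {m : ℝ} (hm : 0 < m) (hle : ∀ x, bitInfluence ν A x ≤ m) :
    ν.real A * (1 - ν.real A) * Real.log (1 / (2 * m)) ≤ 4 * ∑ x, bitInfluence ν A x := by
  have hl := Finset.nodup_toList (Finset.univ : Finset K)
  have hmem : ∀ x : K, x ∈ (Finset.univ : Finset K).toList := by simp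
  set l := (Finset.univ : Finset K).toList with hldef
  let ω : K → Bool := fun _ => true
  have hcyl : agreeOff l ω = Set.univ := Set.eq_univ_of_forall fun η y hy => absurd (hmem y) hy
  have hinf := fun {k x} hk => influence_revealTree_le hpos hlat hA hl hmem ω (k := k) (x := x) hk
  have hD := dom_revealTree hpos hlat hA hl (ω := ω) (ω' := ω) fun _ _ => le_rfl
  have hmean := mean_revealTree (A := A) hpos hl ω
  rw [hcyl, probReal_univ, mul_one, Set.inter_univ] at hmean
  have := hD.variance_mul_log_le hm fun k hk =>
    (hinf (List.getElem?_eq_getElem hk)).trans (hle _)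
  rw [hmean] at this
  refine this.trans (mul_le_mul_of_nonneg_left ?_ (by norm_num))
  refine (sum_range_le_sum_map fun k x hk => hinf hk).trans (le_of_eq ?_)
  rw [hldef, Finset.sum_map_toList]

lemma bitInfluence_nonneg [IsProbabilityMeasure ν]
    (hpos : ∀ l ω, 0 < ν.real (agreeOff l ω))
    (hlat : ∀ l ω ω', ν.real (agreeOff l ω) * ν.real (agreeOff l ω')
      ≤ ν.real (agreeOff l (ω ⊔ ω')) * ν.real (agreeOff l (ω ⊓ ω')))
    (hA : IsUpperSet A) (x : K) : 0 ≤ bitInfluence ν A x := by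
  have hl := Finset.nodup_toList (Finset.univ : Finset K)
  have hmem : ∀ x : K, x ∈ (Finset.univ : Finset K).toList := by simp
  obtain ⟨k, hk⟩ := List.mem_iff_getElem?.1 (hmem x)
  exact ((dom_revealTree hpos hlat hA hl (ω := fun _ => true) fun _ _ => le_rfl).influence_nonneg
    k).trans (influence_revealTree_le hpos hlat hA hl hmem _ hk)

end Cube

/-! ### Level sets -/

lemma measurable_signs {K : Type*} (h : ℝ) : Measurable fun (φ : K → ℝ) x => decide (h ≤ φ x) :=
  measurable_pi_lambda _ fun x => by
    refine measurable_to_bool ?_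
    have : (fun φ : K → ℝ => decide (h ≤ φ x)) ⁻¹' {true} = {φ | h ≤ φ x} := by ext; simp
    rw [this]
    exact measurableSet_le measurable_const (measurable_pi_apply x)

lemma measurableSet_levSet {K : Type} [Fintype K] (A : Set (K → Bool)) (h : ℝ) :
    MeasurableSet (levSet A h) :=
  measurable_signs h MeasurableSet.of_discrete

/-! ### Gaussian Gibbs measures -/

section Gibbs

open ProbabilityTheory

variable {K : Type*} [Fintype K] (c : K → K → ℝ) (κ : K → ℝ)

/-- The energy of a Gaussian field with conductances `c` and masses `κ`. -/
noncomputable def energy (φ : K → ℝ) : ℝ :=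
  (1 / 2) * ∑ x, ∑ y, c x y * (φ y - φ x) ^ 2 + ∑ x, κ x * (φ x) ^ 2

/-- The symmetric bilinear form polarizing `energy`. -/
noncomputable def energyForm : LinearMap.BilinForm ℝ (K → ℝ) :=
  let coord (x : K) : (K → ℝ) →ₗ[ℝ] ℝ := LinearMap.proj x
  (1 / 2 : ℝ) • ∑ x, ∑ y, c x y •
      LinearMap.BilinForm.linMulLin (coord y - coord x) (coord y - coord x)
    + ∑ x, κ x • LinearMap.BilinForm.linMulLin (coord x) (coord x)

lemma energyForm_apply (u φ : K → ℝ) : energyForm c κ u φ =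
    (1 / 2) * ∑ x, ∑ y, c x y * ((u y - u x) * (φ y - φ x)) + ∑ x, κ x * (u x * φ x) := by
  simp [energyForm, LinearMap.sum_apply]

lemma energyForm_const (s : ℝ) (φ : K → ℝ) :
    energyForm c κ (fun _ => s) φ = s * ∑ x, κ x * φ x := by
  simp [energyForm_apply, Finset.mul_sum, mul_left_comm]

lemma energyForm_self (φ : K → ℝ) : energyForm c κ φ φ = energy c κ φ := by
  simp [energyForm_apply, energy, sq]

lemma energyForm_comm (u φ : K → ℝ) : energyForm c κ u φ = energyForm c κ φ u := by
  simp only [energyForm_apply, mul_comm (u _ - u _), mul_comm (u _)]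

lemma energy_add (φ u : K → ℝ) :
    energy c κ (φ + u) = energy c κ φ + 2 * energyForm c κ u φ + energy c κ u := by
  rw [← energyForm_self, map_add, map_add, LinearMap.add_apply, LinearMap.add_apply,
    energyForm_comm c κ φ u, energyForm_self, energyForm_self]
  ring

lemma energy_smul (r : ℝ) (φ : K → ℝ) : energy c κ (r • φ) = r ^ 2 * energy c κ φ := by
  rw [← energyForm_self, map_smul, map_smul, LinearMap.smul_apply, energyForm_self]
  simp only [smul_eq_mul]
  ring

@[fun_prop]
lemma continuous_energy : Continuous (energy c κ) := by
  unfold energy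
  fun_prop

variable {c κ}

lemma sum_le_energy (hc : ∀ x y, 0 ≤ c x y) (φ : K → ℝ) : ∑ x, κ x * φ x ^ 2 ≤ energy c κ φ :=
  le_add_of_nonneg_left <| mul_nonneg (by norm_num) <| Finset.sum_nonneg fun x _ =>
    Finset.sum_nonneg fun y _ => mul_nonneg (hc x y) (sq_nonneg _)

/-- Every coordinate is represented by the energy form. -/
lemma exists_energyForm_eq_apply (hc : ∀ x y, 0 ≤ c x y) (hκ : ∀ x, 0 < κ x) (x : K) :
    ∃ u, ∀ φ, energyForm c κ u φ = φ x := by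
  have hnd : (energyForm c κ).Nondegenerate := by
    have hzero : ∀ u, energyForm c κ u u = 0 → u = 0 := fun u hu => by
      rw [energyForm_self] at hu
      have hs := (sum_le_energy (κ := κ) hc u).trans hu.le
      ext y
      have hy := (Finset.sum_eq_zero_iff_of_nonneg fun z _ =>
        mul_nonneg (hκ z).le (sq_nonneg (u z))).1
          (hs.antisymm (Finset.sum_nonneg fun z _ => mul_nonneg (hκ z).le (sq_nonneg (u z)))) y
            (Finset.mem_univ y)
      simpa [(hκ y).ne'] using hy
    exact ⟨fun u hu => hzero u (hu u), fun u hu => hzero u (hu u)⟩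
  refine ⟨((energyForm c κ).toDual hnd).symm (LinearMap.proj x), fun φ => ?_⟩
  rw [← LinearMap.BilinForm.toDual_def hnd, LinearEquiv.apply_symm_apply]
  rfl

lemma integrable_exp_sum_sub_energy (hc : ∀ x y, 0 ≤ c x y) (hκ : ∀ x, 0 < κ x) (a : K → ℝ) :
    Integrable fun φ : K → ℝ => exp (∑ x, a x * φ x - energy c κ φ / 2) := by
  have h1 : ∀ x, Integrable fun t : ℝ => exp (a x * t - κ x * t ^ 2 / 2) := fun x => by
    have := (integrable_cexp_quadratic (b := ((κ x / 2 : ℝ) : ℂ))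
      (by simpa only [Complex.ofReal_re] using half_pos (hκ x)) (a x) 0).re
    refine this.congr (.of_forall fun t => ?_)
    have : -((κ x / 2 : ℝ) : ℂ) * (t : ℂ) ^ 2 + (a x : ℂ) * t + 0
        = ((a x * t - κ x * t ^ 2 / 2 : ℝ) : ℂ) := by
      push_cast; ring
    simp only [this, RCLike.re_to_complex, Complex.exp_ofReal_re]
  refine (Integrable.fintype_prod h1).mono' (by fun_prop) (.of_forall fun φ => ?_)
  rw [norm_of_nonneg (exp_pos _).le, ← exp_sum, exp_le_exp, Finset.sum_sub_distrib,
    ← Finset.sum_div]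
  linarith [sum_le_energy (κ := κ) hc φ]

lemma integrable_exp_neg_energy (hc : ∀ x y, 0 ≤ c x y) (hκ : ∀ x, 0 < κ x) :
    Integrable fun φ : K → ℝ => exp (-energy c κ φ / 2) := by
  simpa [neg_div] using integrable_exp_sum_sub_energy hc hκ 0

variable (c κ)

/-- The partition function. -/
noncomputable def partitionFun : ℝ := ∫ φ : K → ℝ, exp (-energy c κ φ / 2)

/-- The Gaussian Gibbs measure. -/
noncomputable def gibbs : Measure (K → ℝ) :=
  volume.withDensity fun φ => ENNReal.ofReal (exp (-energy c κ φ / 2) / partitionFun c κ)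

variable {c κ}

lemma partitionFun_pos (hc : ∀ x y, 0 ≤ c x y) (hκ : ∀ x, 0 < κ x) : 0 < partitionFun c κ :=
  integral_exp_pos (integrable_exp_neg_energy hc hκ)

lemma partitionFun_nonneg : 0 ≤ partitionFun c κ := integral_nonneg fun _ => (exp_pos _).le

lemma isProbabilityMeasure_gibbs (hc : ∀ x y, 0 ≤ c x y) (hκ : ∀ x, 0 < κ x) :
    IsProbabilityMeasure (gibbs c κ) := by
  constructor
  rw [gibbs, withDensity_apply _ .univ, Measure.restrict_univ, ← ofReal_integral_eq_lintegral_ofReal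
    ((integrable_exp_neg_energy hc hκ).div_const _)
    (.of_forall fun φ => div_nonneg (exp_pos _).le partitionFun_nonneg), integral_div]
  exact ENNReal.ofReal_eq_one.2 (div_self (partitionFun_pos hc hκ).ne')

lemma measurable_gibbs_density : Measurable fun φ =>
    ENNReal.ofReal (exp (-energy c κ φ / 2) / partitionFun c κ) :=
  (by fun_prop :
    Continuous fun φ => exp (-energy c κ φ / 2) / partitionFun c κ).measurable.ennreal_ofReal

lemma integral_gibbs (f : (K → ℝ) → ℝ) :
    ∫ φ, f φ ∂gibbs c κ = ∫ φ, exp (-energy c κ φ / 2) / partitionFun c κ * f φ := by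
  rw [gibbs, integral_withDensity_eq_integral_toReal_smul measurable_gibbs_density
    (.of_forall fun _ => ENNReal.ofReal_lt_top)]
  refine integral_congr_ae (.of_forall fun φ => ?_)
  simp only [ENNReal.toReal_ofReal (div_nonneg (exp_pos _).le partitionFun_nonneg), smul_eq_mul]

/-- The Cameron-Martin formula. -/
lemma integral_gibbs_shift (f : (K → ℝ) → ℝ) (u : K → ℝ) :
    ∫ φ, f φ ∂gibbs c κ
      = exp (-energy c κ u / 2) * ∫ φ, f (φ + u) * exp (-energyForm c κ u φ) ∂gibbs c κ := by
  rw [integral_gibbs, integral_gibbs, ← integral_add_right_eq_self _ u, ← integral_const_mul]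
  refine integral_congr_ae (.of_forall fun φ => ?_)
  have : exp (-energy c κ (φ + u) / 2)
      = exp (-energy c κ u / 2) * exp (-energy c κ φ / 2) * exp (-energyForm c κ u φ) := by
    rw [← exp_add, ← exp_add, energy_add]
    congr 1
    ring
  simp only [this]
  ring

lemma integrable_exp_sum_gibbs (hc : ∀ x y, 0 ≤ c x y) (hκ : ∀ x, 0 < κ x) (a : K → ℝ) :
    Integrable (fun φ : K → ℝ => exp (∑ x, a x * φ x)) (gibbs c κ) := by
  rw [gibbs, integrable_withDensity_iff_integrable_smul' measurable_gibbs_density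
    (.of_forall fun _ => ENNReal.ofReal_lt_top)]
  refine ((integrable_exp_sum_sub_energy hc hκ a).div_const (partitionFun c κ)).congr
    (.of_forall fun φ => ?_)
  simp only [ENNReal.toReal_ofReal (div_nonneg (exp_pos _).le partitionFun_nonneg), smul_eq_mul]
  rw [sub_eq_neg_add, exp_add, neg_div]
  ring

/-- The one-dimensional marginals of a Gaussian Gibbs measure are centred Gaussians. -/
lemma map_apply_gibbs (hc : ∀ x y, 0 ≤ c x y) (hκ : ∀ x, 0 < κ x) (x : K) :
    ∃ v, (gibbs c κ).map (fun φ => φ x) = gaussianReal 0 v := by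
  classical
  have := isProbabilityMeasure_gibbs hc hκ
  obtain ⟨u, hu⟩ := exists_energyForm_eq_apply hc hκ x
  have hE : 0 ≤ energy c κ u := (Finset.sum_nonneg fun y _ =>
    mul_nonneg (hκ y).le (sq_nonneg (u y))).trans (sum_le_energy hc u)
  refine ⟨(energy c κ u).toNNReal, ?_⟩
  have hm : Measurable fun φ : K → ℝ => φ x := measurable_pi_apply x
  have hprob := Measure.isProbabilityMeasure_map (μ := gibbs c κ) hm.aemeasurable
  have hset : integrableExpSet id ((gibbs c κ).map fun φ => φ x) = Set.univ := by
    refine Set.eq_univ_of_forall fun t => ?_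
    rw [integrableExpSet, Set.mem_ofPred_eq, integrable_map_measure (by fun_prop) hm.aemeasurable]
    simpa [Function.comp_def, Pi.single_apply, ite_mul] using
      integrable_exp_sum_gibbs hc hκ (Pi.single x t)
  have hmgf : mgf id ((gibbs c κ).map fun φ => φ x)
      = mgf id (gaussianReal 0 (energy c κ u).toNNReal) := by
    ext t
    have h := integral_gibbs_shift (c := c) (κ := κ) (fun _ => 1) ((-t) • u)
    simp only [integral_const, probReal_univ, one_mul, map_smul, LinearMap.smul_apply,
      hu, smul_eq_mul, neg_mul, neg_neg, energy_smul] at h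
    rw [congrFun mgf_id_gaussianReal t, mgf_id_map hm.aemeasurable, mgf]
    have h2 := congrArg (exp (t ^ 2 * energy c κ u / 2) * ·) h
    simp only [mul_one, ← mul_assoc, ← exp_add] at h2
    rw [show t ^ 2 * energy c κ u / 2 + -((-t) ^ 2 * energy c κ u) / 2 = 0 by ring, exp_zero,
      one_mul] at h2
    rw [← h2]
    simp [mul_comm, Real.coe_toNNReal _ hE]
  refine Measure.ext_of_complexMGF_id_eq (funext fun z => eqOn_complexMGF_of_mgf hmgf ?_)
  simp [hset]

lemma integrableExpSet_sum_gibbs (hc : ∀ x y, 0 ≤ c x y) (hκ : ∀ x, 0 < κ x) (a : K → ℝ) :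
    integrableExpSet (fun φ : K → ℝ => ∑ x, a x * φ x) (gibbs c κ) = Set.univ :=
  Set.eq_univ_of_forall fun t => by
    simpa [integrableExpSet, Finset.mul_sum, mul_assoc] using
      integrable_exp_sum_gibbs hc hκ fun x => t * a x

lemma integrable_sum_gibbs (hc : ∀ x y, 0 ≤ c x y) (hκ : ∀ x, 0 < κ x) (a : K → ℝ) :
    Integrable (fun φ : K → ℝ => ∑ x, a x * φ x) (gibbs c κ) := by
  have := integrable_pow_of_mem_interior_integrableExpSet
    (X := fun φ : K → ℝ => ∑ x, a x * φ x) (μ := gibbs c κ)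
    (by simp [integrableExpSet_sum_gibbs hc hκ]) 1
  simpa using this

lemma integrable_apply_gibbs (hc : ∀ x y, 0 ≤ c x y) (hκ : ∀ x, 0 < κ x) (x : K) :
    Integrable (fun φ : K → ℝ => φ x) (gibbs c κ) := by
  classical
  simpa [Pi.single_apply, ite_mul] using integrable_sum_gibbs hc hκ (Pi.single x 1)

lemma integral_apply_gibbs (hc : ∀ x y, 0 ≤ c x y) (hκ : ∀ x, 0 < κ x) (x : K) :
    ∫ φ, φ x ∂gibbs c κ = 0 := by
  obtain ⟨v, hv⟩ := map_apply_gibbs hc hκ x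
  have h := integral_map (μ := gibbs c κ) (measurable_pi_apply x).aemeasurable (f := id)
    (by fun_prop)
  rw [hv] at h
  simpa using h.symm

/-! ### The derivative in the level -/

lemma hasDerivAt_gibbs_levSet {K : Type} [Fintype K] {c : K → K → ℝ} {κ : K → ℝ}
    (hc : ∀ x y, 0 ≤ c x y) (hκ : ∀ x, 0 < κ x) (A : Set (K → Bool)) (h : ℝ) :
    HasDerivAt (fun h' => (gibbs c κ).real (levSet A h'))
      (-∑ x, κ x * ∫ φ in levSet A h, φ x ∂gibbs c κ) h := by
  have := isProbabilityMeasure_gibbs hc hκ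
  let X : (K → ℝ) → ℝ := fun φ => ∑ x, -κ x * φ x
  let μA := (gibbs c κ).restrict (levSet A h)
  have hX : 0 ∈ interior (integrableExpSet X μA) := by
    have : integrableExpSet X μA = Set.univ := Set.eq_univ_of_forall fun t =>
      Integrable.restrict ((integrableExpSet_sum_gibbs hc hκ fun x => -κ x).ge (Set.mem_univ t))
    simp [this]
  have hlev : ∀ h', (gibbs c κ).real (levSet A h')
      = exp (-((h' - h) ^ 2 * energy c κ 1) / 2) * mgf X μA (h' - h) := fun h' => by
    rw [← integral_indicator_one (measurableSet_levSet A h'), integral_gibbs_shift _ ((h' - h) • 1),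
      energy_smul, mgf, ← integral_indicator (measurableSet_levSet A h)]
    congr 2
    ext φ
    have hmem : φ + (h' - h) • 1 ∈ levSet A h' ↔ φ ∈ levSet A h := by
      have : ∀ x, h' ≤ φ x + (h' - h) ↔ h ≤ φ x := fun x =>
        ⟨fun hx => by linarith, fun hx => by linarith⟩
      simp [levSet, this]
    have hB : -energyForm c κ ((h' - h) • 1) φ = (h' - h) * X φ := by
      have : (h' - h) • (1 : K → ℝ) = fun _ => h' - h := by ext; simp
      rw [this, energyForm_const]
      simp [X]
    by_cases hφ : φ ∈ levSet A h
    · rw [hB, Set.indicator_of_mem hφ, Set.indicator_of_mem (hmem.2 hφ), Pi.one_apply, one_mul]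
    · simp [hmem, hφ]
  have hmgf : HasDerivAt (fun h' => mgf X μA (h' - h)) (∫ φ, X φ ∂μA) h := by
    have := hasDerivAt_mgf (X := X) (μ := μA) hX
    simp only [zero_mul, exp_zero, mul_one] at this
    rw [← sub_self h] at this
    simpa using this.comp_sub_const h h
  have hexp : HasDerivAt (fun h' => exp (-((h' - h) ^ 2 * energy c κ 1) / 2)) 0 h := by
    have := (((((hasDerivAt_id h).sub_const h).pow 2).mul_const (energy c κ 1)).neg.div_const 2).exp
    simpa using this
  simp_rw [hlev]
  refine (hexp.mul hmgf).congr_deriv ?_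
  rw [sub_self, zero_mul, zero_add]
  simp only [ne_eq, OfNat.ofNat_ne_zero, not_false_eq_true, zero_pow, zero_mul, neg_zero, zero_div,
    exp_zero, one_mul, X]
  rw [integral_finsetSum _ fun x _ => ((integrable_apply_gibbs hc hκ x).restrict).const_mul _]
  simp_rw [integral_const_mul, neg_mul, Finset.sum_neg_distrib]

/-! ### Positive association -/

lemma energy_sup_add_energy_inf_le (hc : ∀ x y, 0 ≤ c x y) (φ ψ : K → ℝ) :
    energy c κ (φ ⊔ ψ) + energy c κ (φ ⊓ ψ) ≤ energy c κ φ + energy c κ ψ := by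
  simp only [energy]
  rw [add_add_add_comm, add_add_add_comm _ _ (1 / 2 * _), ← mul_add, ← mul_add,
    ← Finset.sum_add_distrib, ← Finset.sum_add_distrib, ← Finset.sum_add_distrib,
    ← Finset.sum_add_distrib]
  simp_rw [← Finset.sum_add_distrib, ← mul_add]
  refine add_le_add (mul_le_mul_of_nonneg_left (Finset.sum_le_sum fun x _ => Finset.sum_le_sum
    fun y _ => mul_le_mul_of_nonneg_left ?_ (hc x y)) (by norm_num))
    (Finset.sum_le_sum fun x _ => le_of_eq (congrArg _ ?_))
  · rcases le_total (φ x) (ψ x) with hx | hx <;> rcases le_total (φ y) (ψ y) with hy | hy <;>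
      simp only [Pi.sup_apply, Pi.inf_apply, sup_of_le_left, sup_of_le_right, inf_of_le_left,
        inf_of_le_right, hx, hy] <;>
      nlinarith [mul_nonneg (sub_nonneg.2 hx) (sub_nonneg.2 hy)]
  · rcases le_total (φ x) (ψ x) with hx | hx <;> simp [hx, add_comm]

lemma lintegral_gibbs_mul_le_of_sup_inf (hc : ∀ x y, 0 ≤ c x y) {α β γ δ : (K → ℝ) → ENNReal}
    (hα : Measurable α) (hβ : Measurable β) (hγ : Measurable γ) (hδ : Measurable δ)
    (h : ∀ φ ψ, α φ * β ψ ≤ γ (φ ⊔ ψ) * δ (φ ⊓ ψ)) :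
    (∫⁻ φ, α φ ∂gibbs c κ) * ∫⁻ φ, β φ ∂gibbs c κ
      ≤ (∫⁻ φ, γ φ ∂gibbs c κ) * ∫⁻ φ, δ φ ∂gibbs c κ := by
  refine lintegral_withDensity_mul_le_of_sup_inf measurable_gibbs_density (fun φ ψ => ?_)
    hα hβ hγ hδ h
  have hpos : ∀ φ, 0 ≤ exp (-energy c κ φ / 2) / partitionFun c κ := fun φ =>
    div_nonneg (exp_pos _).le partitionFun_nonneg
  rw [← ENNReal.ofReal_mul (hpos _), ← ENNReal.ofReal_mul (hpos _), div_mul_div_comm,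
    div_mul_div_comm, ← exp_add, ← exp_add]
  have := energy_sup_add_energy_inf_le (κ := κ) hc φ ψ
  have := partitionFun_nonneg (c := c) (κ := κ)
  gcongr ENNReal.ofReal (exp ?_ / _)
  linarith

/-- The four functions theorem for the Gaussian Gibbs measure, for real-valued functions. -/
lemma integral_gibbs_mul_le_of_sup_inf (hc : ∀ x y, 0 ≤ c x y) {α β γ δ : (K → ℝ) → ℝ}
    (hα : Measurable α) (hβ : Measurable β) (hγ : Measurable γ) (hδ : Measurable δ)
    (hα₀ : 0 ≤ α) (hβ₀ : 0 ≤ β) (hγ₀ : 0 ≤ γ) (hδ₀ : 0 ≤ δ)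
    (hγi : Integrable γ (gibbs c κ)) (hδi : Integrable δ (gibbs c κ))
    (h : ∀ φ ψ, α φ * β ψ ≤ γ (φ ⊔ ψ) * δ (φ ⊓ ψ)) :
    (∫ φ, α φ ∂gibbs c κ) * ∫ φ, β φ ∂gibbs c κ
      ≤ (∫ φ, γ φ ∂gibbs c κ) * ∫ φ, δ φ ∂gibbs c κ := by
  have conv : ∀ {f : (K → ℝ) → ℝ}, Measurable f → 0 ≤ f →
      ∫ φ, f φ ∂gibbs c κ = (∫⁻ φ, ENNReal.ofReal (f φ) ∂gibbs c κ).toReal := fun hf hf₀ =>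
    integral_eq_lintegral_of_nonneg_ae (.of_forall hf₀) hf.aestronglyMeasurable
  rw [conv hα hα₀, conv hβ hβ₀, conv hγ hγ₀, conv hδ hδ₀, ← ENNReal.toReal_mul,
    ← ENNReal.toReal_mul]
  refine ENNReal.toReal_mono (ENNReal.mul_ne_top (Integrable.lintegral_lt_top hγi).ne
    (Integrable.lintegral_lt_top hδi).ne) ?_
  refine lintegral_gibbs_mul_le_of_sup_inf hc hα.ennreal_ofReal hβ.ennreal_ofReal
    hγ.ennreal_ofReal hδ.ennreal_ofReal fun φ ψ => ?_
  rw [← ENNReal.ofReal_mul (hα₀ φ), ← ENNReal.ofReal_mul (hγ₀ _)]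
  exact ENNReal.ofReal_le_ofReal (h φ ψ)

lemma gibbs_inter_mul_setIntegral_le (hc : ∀ x y, 0 ≤ c x y) (hκ : ∀ x, 0 < κ x)
    {S : Set (K → ℝ)} (hS : IsUpperSet S) (hSm : MeasurableSet S) (h : ℝ) (x : K) :
    (gibbs c κ).real (S ∩ {φ | h ≤ φ x}) * ∫ φ in {φ | h ≤ φ x}, φ x ∂gibbs c κ
      ≤ (gibbs c κ).real {φ | h ≤ φ x} * ∫ φ in S ∩ {φ | h ≤ φ x}, φ x ∂gibbs c κ := by
  have := isProbabilityMeasure_gibbs hc hκ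
  have hxm := measurable_pi_apply (X := fun _ : K => ℝ) x
  have hBm : MeasurableSet {φ : K → ℝ | h ≤ φ x} := measurableSet_le measurable_const hxm
  have hi := (integrable_apply_gibbs hc hκ x).sub (integrable_const h)
  have key := integral_gibbs_mul_le_of_sup_inf (κ := κ) hc
    (α := (S ∩ {φ | h ≤ φ x}).indicator 1)
    (β := {φ | h ≤ φ x}.indicator fun φ => φ x - h)
    (γ := (S ∩ {φ | h ≤ φ x}).indicator fun φ => φ x - h)
    (δ := {φ | h ≤ φ x}.indicator 1)
    (measurable_one.indicator (hSm.inter hBm)) ((hxm.sub_const h).indicator hBm)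
    ((hxm.sub_const h).indicator (hSm.inter hBm)) (measurable_one.indicator hBm)
    (Set.indicator_nonneg fun _ _ => zero_le_one) (Set.indicator_nonneg fun _ hφ => sub_nonneg.2 hφ)
    (Set.indicator_nonneg fun _ hφ => sub_nonneg.2 hφ.2)
    (Set.indicator_nonneg fun _ _ => zero_le_one)
    (hi.indicator (hSm.inter hBm)) ((integrable_const 1).indicator hBm) ?_
  · rw [integral_indicator_one (hSm.inter hBm), integral_indicator_one hBm, integral_indicator hBm,
      integral_indicator (hSm.inter hBm),
      integral_sub (integrable_apply_gibbs hc hκ x).integrableOn (integrable_const h).integrableOn,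
      integral_sub (integrable_apply_gibbs hc hκ x).integrableOn (integrable_const h).integrableOn,
      setIntegral_const, setIntegral_const, smul_eq_mul, smul_eq_mul] at key
    linarith
  · intro φ ψ
    by_cases hφ : φ ∈ S ∩ {φ | h ≤ φ x}
    · by_cases hψ : ψ ∈ {φ : K → ℝ | h ≤ φ x}
      · have h1 : φ ⊔ ψ ∈ S ∩ {φ | h ≤ φ x} := 
          ⟨hS le_sup_left hφ.1, (le_sup_of_le_left hφ.2 : h ≤ φ x ⊔ ψ x)⟩
        have h2 : φ ⊓ ψ ∈ {φ : K → ℝ | h ≤ φ x} := (le_inf hφ.2 hψ : h ≤ φ x ⊓ ψ x)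
        rw [Set.indicator_of_mem hφ, Set.indicator_of_mem hψ, Set.indicator_of_mem h1,
          Set.indicator_of_mem h2]
        simp
      · rw [Set.indicator_of_notMem hψ, mul_zero]
        exact mul_nonneg (Set.indicator_nonneg (fun _ hφ => sub_nonneg.2 hφ.2) _)
          (Set.indicator_nonneg (fun _ _ => zero_le_one) _)
    · rw [Set.indicator_of_notMem hφ, zero_mul]
      exact mul_nonneg (Set.indicator_nonneg (fun _ hφ => sub_nonneg.2 hφ.2) _)
        (Set.indicator_nonneg (fun _ _ => zero_le_one) _)

lemma gibbs_inter_mul_setIntegral_ge (hc : ∀ x y, 0 ≤ c x y) (hκ : ∀ x, 0 < κ x)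
    {S : Set (K → ℝ)} (hS : IsLowerSet S) (hSm : MeasurableSet S) (h : ℝ) (x : K) :
    (gibbs c κ).real {φ | φ x < h} * ∫ φ in S ∩ {φ | φ x < h}, φ x ∂gibbs c κ
      ≤ (gibbs c κ).real (S ∩ {φ | φ x < h}) * ∫ φ in {φ | φ x < h}, φ x ∂gibbs c κ := by
  have := isProbabilityMeasure_gibbs hc hκ
  have hxm := measurable_pi_apply (X := fun _ : K => ℝ) x
  have hBm : MeasurableSet {φ : K → ℝ | φ x < h} := measurableSet_lt hxm measurable_const
  have hi := (integrable_const h).sub (integrable_apply_gibbs hc hκ x)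
  have nonneg : ∀ φ ∈ {φ : K → ℝ | φ x < h}, 0 ≤ h - φ x := fun φ hφ => sub_nonneg.2 (le_of_lt hφ)
  have key := integral_gibbs_mul_le_of_sup_inf (κ := κ) hc
    (α := (S ∩ {φ | φ x < h}).indicator 1)
    (β := {φ | φ x < h}.indicator fun φ => h - φ x)
    (γ := {φ | φ x < h}.indicator 1)
    (δ := (S ∩ {φ | φ x < h}).indicator fun φ => h - φ x)
    (measurable_one.indicator (hSm.inter hBm)) ((hxm.const_sub h).indicator hBm)
    (measurable_one.indicator hBm) ((hxm.const_sub h).indicator (hSm.inter hBm))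
    (Set.indicator_nonneg fun _ _ => zero_le_one) (Set.indicator_nonneg nonneg)
    (Set.indicator_nonneg fun _ _ => zero_le_one)
    (Set.indicator_nonneg fun φ hφ => nonneg φ hφ.2)
    ((integrable_const 1).indicator hBm) (hi.indicator (hSm.inter hBm)) ?_
  · rw [integral_indicator_one (hSm.inter hBm), integral_indicator_one hBm, integral_indicator hBm,
      integral_indicator (hSm.inter hBm),
      integral_sub (integrable_const h).integrableOn (integrable_apply_gibbs hc hκ x).integrableOn,
      integral_sub (integrable_const h).integrableOn (integrable_apply_gibbs hc hκ x).integrableOn,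
      setIntegral_const, setIntegral_const, smul_eq_mul, smul_eq_mul] at key
    linarith
  · intro φ ψ
    by_cases hφ : φ ∈ S ∩ {φ | φ x < h}
    · by_cases hψ : ψ ∈ {φ : K → ℝ | φ x < h}
      · have h1 : φ ⊓ ψ ∈ S ∩ {φ | φ x < h} :=
          ⟨hS inf_le_left hφ.1, (inf_le_left : (φ ⊓ ψ) x ≤ φ x).trans_lt hφ.2⟩
        have h2 : φ ⊔ ψ ∈ {φ : K → ℝ | φ x < h} := (max_lt hφ.2 hψ : φ x ⊔ ψ x < h)
        rw [Set.indicator_of_mem hφ, Set.indicator_of_mem hψ, Set.indicator_of_mem h1,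
          Set.indicator_of_mem h2]
        simp only [Pi.one_apply, one_mul, Pi.inf_apply]
        linarith [inf_le_right (a := φ x) (b := ψ x)]
      · rw [Set.indicator_of_notMem hψ, mul_zero]
        exact mul_nonneg (Set.indicator_nonneg (fun _ _ => zero_le_one) _)
          (Set.indicator_nonneg (fun φ hφ => nonneg φ hφ.2) _)
    · rw [Set.indicator_of_notMem hφ, zero_mul]
      exact mul_nonneg (Set.indicator_nonneg (fun _ _ => zero_le_one) _)
        (Set.indicator_nonneg (fun φ hφ => nonneg φ hφ.2) _)

lemma gibbs_real_pos_of_isOpen (hc : ∀ x y, 0 ≤ c x y) (hκ : ∀ x, 0 < κ x) {U : Set (K → ℝ)}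
    (hU : IsOpen U) (hne : U.Nonempty) : 0 < (gibbs c κ).real U := by
  have := isProbabilityMeasure_gibbs hc hκ
  refine measureReal_nonneg.lt_of_ne' fun h0 => (hU.measure_pos volume hne).ne' ?_
  rw [measureReal_eq_zero_iff] at h0
  rw [gibbs, withDensity_apply_eq_zero measurable_gibbs_density] at h0
  convert h0 using 2
  refine (Set.inter_eq_right.2 fun φ _ => ?_).symm
  simpa using div_pos (exp_pos _) (partitionFun_pos hc hκ)

end Gibbs

section SignLaw

variable {K : Type} [Fintype K] {c : K → K → ℝ} {κ : K → ℝ}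

/-- The law of the signs of `φ - h` under the Gaussian Gibbs measure. -/
noncomputable def signLaw (c : K → K → ℝ) (κ : K → ℝ) (h : ℝ) : Measure (K → Bool) :=
  (gibbs c κ).map fun φ x => decide (h ≤ φ x)

lemma isProbabilityMeasure_signLaw (hc : ∀ x y, 0 ≤ c x y) (hκ : ∀ x, 0 < κ x) (h : ℝ) :
    IsProbabilityMeasure (signLaw c κ h) :=
  have := isProbabilityMeasure_gibbs hc hκ
  Measure.isProbabilityMeasure_map (measurable_signs h).aemeasurable

lemma signLaw_real (h : ℝ) (A : Set (K → Bool)) :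
    (signLaw c κ h).real A = (gibbs c κ).real (levSet A h) :=
  map_measureReal_apply (measurable_signs h) MeasurableSet.of_discrete

lemma condInfl_gibbs (A : Set (K → Bool)) (h : ℝ) (x : K) :
    condInfl (gibbs c κ) A h x = bitInfluence (signLaw c κ h) A x := by
  have h1 : levSet {η : K → Bool | η x = true} h = {φ | h ≤ φ x} := by ext; simp [levSet]
  have h0 : levSet {η : K → Bool | η x = false} h = {φ | φ x < h} := by ext; simp [levSet]
  rw [bitInfluence, signLaw_real, signLaw_real, signLaw_real, signLaw_real, h1, h0, ← h1, ← h0]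
  rw [condInfl, ← h1, ← h0]
  rfl

lemma signLaw_agreeOff_pos (hc : ∀ x y, 0 ≤ c x y) (hκ : ∀ x, 0 < κ x) (h : ℝ) (l : List K)
    (ω : K → Bool) : 0 < (signLaw c κ h).real (agreeOff l ω) := by
  have := isProbabilityMeasure_gibbs hc hκ
  let I : K → Set ℝ := fun x => if ω x then Set.Ioi h else Set.Iio h
  have hI : ∀ x, IsOpen (I x) ∧ (I x).Nonempty := fun x => by
    by_cases hx : ω x
    · simp only [I, hx, if_true]
      exact ⟨isOpen_Ioi, Set.nonempty_Ioi⟩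
    · simp only [I, hx, Bool.false_eq_true, if_false]
      exact ⟨isOpen_Iio, Set.nonempty_Iio⟩
  rw [signLaw_real]
  refine (gibbs_real_pos_of_isOpen hc hκ (isOpen_set_pi Set.finite_univ fun x _ => (hI x).1)
    (Set.univ_pi_nonempty_iff.2 fun x => (hI x).2)).trans_le
    (measureReal_mono fun φ hφ x _ => ?_)
  have hx : φ x ∈ I x := hφ x (Set.mem_univ x)
  cases hω : ω x
  · simpa [I, hω] using hx
  · simpa [I, hω] using (le_of_lt (by simpa [I, hω] using hx) : h ≤ φ x)

lemma signLaw_lattice (hc : ∀ x y, 0 ≤ c x y) (hκ : ∀ x, 0 < κ x) (h : ℝ) (l : List K)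
    (ω ω' : K → Bool) :
    (signLaw c κ h).real (agreeOff l ω) * (signLaw c κ h).real (agreeOff l ω')
      ≤ (signLaw c κ h).real (agreeOff l (ω ⊔ ω'))
        * (signLaw c κ h).real (agreeOff l (ω ⊓ ω')) := by
  have := isProbabilityMeasure_gibbs hc hκ
  have hm := fun ω => measurableSet_levSet (agreeOff l ω) h
  simp only [signLaw_real, ← integral_indicator_one (hm _)]
  have nonneg : ∀ ω : K → Bool, 0 ≤ (levSet (agreeOff l ω) h).indicator (1 : (K → ℝ) → ℝ) :=
    fun ω => Set.indicator_nonneg fun _ _ => zero_le_one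
  have int : ∀ ω : K → Bool, Integrable ((levSet (agreeOff l ω) h).indicator (1 : (K → ℝ) → ℝ))
      (gibbs c κ) := fun ω => (integrable_const 1).indicator (hm ω)
  refine integral_gibbs_mul_le_of_sup_inf hc (measurable_one.indicator (hm _))
    (measurable_one.indicator (hm _)) (measurable_one.indicator (hm _))
    (measurable_one.indicator (hm _)) (nonneg _) (nonneg _) (nonneg _) (nonneg _) (int _) (int _)
    fun φ ψ => ?_
  by_cases hφ : φ ∈ levSet (agreeOff l ω) h
  · by_cases hψ : ψ ∈ levSet (agreeOff l ω') h
    · have h1 : φ ⊔ ψ ∈ levSet (agreeOff l (ω ⊔ ω')) h := fun x hx => by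
        have h1 := hφ x hx
        have h2 := hψ x hx
        simp only at h1 h2
        simp [← h1, ← h2]
      have h2 : φ ⊓ ψ ∈ levSet (agreeOff l (ω ⊓ ω')) h := fun x hx => by
        have h1 := hφ x hx
        have h2 := hψ x hx
        simp only at h1 h2
        simp [← h1, ← h2]
      rw [Set.indicator_of_mem hφ, Set.indicator_of_mem hψ, Set.indicator_of_mem h1,
        Set.indicator_of_mem h2]
      simp
    · rw [Set.indicator_of_notMem hψ, mul_zero]
      exact mul_nonneg (nonneg _ _) (nonneg _ _)
  · rw [Set.indicator_of_notMem hφ, zero_mul]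
    exact mul_nonneg (nonneg _ _) (nonneg _ _)

lemma condInfl_mul_setIntegral_le (hc : ∀ x y, 0 ≤ c x y) (hκ : ∀ x, 0 < κ x)
    {A : Set (K → Bool)} (hA : IsUpperSet A) (h : ℝ) (x : K) :
    condInfl (gibbs c κ) A h x * ∫ φ in {φ | h ≤ φ x}, φ x ∂gibbs c κ
      ≤ ∫ φ in levSet A h, φ x ∂gibbs c κ := by
  have := isProbabilityMeasure_gibbs hc hκ
  have hxint := integrable_apply_gibbs hc hκ x
  have hm := measurableSet_levSet A h
  have hxm := measurable_pi_apply (X := fun _ : K => ℝ) x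
  have hBm : MeasurableSet {φ : K → ℝ | h ≤ φ x} := measurableSet_le measurable_const hxm
  have hBm' : MeasurableSet {φ : K → ℝ | φ x < h} := measurableSet_lt hxm measurable_const
  have hcompl : {φ : K → ℝ | h ≤ φ x}ᶜ = {φ | φ x < h} := by ext; simp
  have hup : IsUpperSet (levSet A h) := fun φ ψ hle hφ => hA (fun x => by
    simpa [Bool.le_iff_imp] using fun hx => hx.trans (hle x)) hφ
  have hB : 0 < (gibbs c κ).real {φ | h ≤ φ x} :=
    (gibbs_real_pos_of_isOpen hc hκ (isOpen_lt continuous_const (continuous_apply x))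
      ⟨fun _ => h + 1, lt_add_one h⟩).trans_le 
        (measureReal_mono (Set.ofPred_subset_ofPred.2 fun φ hφ => le_of_lt hφ))
  have hB' : 0 < (gibbs c κ).real {φ | φ x < h} :=
    gibbs_real_pos_of_isOpen hc hκ (isOpen_lt (continuous_apply x) continuous_const)
      ⟨fun _ => h - 1, sub_one_lt h⟩
  have key₁ := gibbs_inter_mul_setIntegral_le hc hκ hup hm h x
  have key₀ := gibbs_inter_mul_setIntegral_ge hc hκ hup.compl hm.compl h x
  have sum₀ : ∫ φ in {φ | h ≤ φ x}, φ x ∂gibbs c κ + ∫ φ in {φ | φ x < h}, φ x ∂gibbs c κ = 0 := by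
    rw [← hcompl, integral_add_compl hBm hxint, integral_apply_gibbs hc hκ]
  have split : ∫ φ in levSet A h ∩ {φ | h ≤ φ x}, φ x ∂gibbs c κ
      + ∫ φ in levSet A h ∩ {φ | φ x < h}, φ x ∂gibbs c κ
        = ∫ φ in levSet A h, φ x ∂gibbs c κ := by
    rw [← hcompl, ← Set.sdiff_eq]
    exact integral_inter_add_sdiff hBm hxint.integrableOn
  have split' : ∫ φ in levSet A h ∩ {φ | φ x < h}, φ x ∂gibbs c κ
      + ∫ φ in (levSet A h)ᶜ ∩ {φ | φ x < h}, φ x ∂gibbs c κ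
        = ∫ φ in {φ | φ x < h}, φ x ∂gibbs c κ := by
    rw [Set.inter_comm, Set.inter_comm _ᶜ, ← Set.sdiff_eq]
    exact integral_inter_add_sdiff hm hxint.integrableOn
  have msplit : (gibbs c κ).real (levSet A h ∩ {φ | φ x < h})
      + (gibbs c κ).real ((levSet A h)ᶜ ∩ {φ | φ x < h}) = (gibbs c κ).real {φ | φ x < h} := by
    rw [Set.inter_comm, Set.inter_comm _ᶜ, ← Set.sdiff_eq]
    exact measureReal_inter_add_sdiff hm
  change ((gibbs c κ).real (levSet A h ∩ {φ | h ≤ φ x}) / (gibbs c κ).real {φ | h ≤ φ x}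
    - (gibbs c κ).real (levSet A h ∩ {φ | φ x < h}) / (gibbs c κ).real {φ | φ x < h}) * _ ≤ _
  generalize ∫ φ in levSet A h ∩ {φ | h ≤ φ x}, φ x ∂gibbs c κ = I₁ at *
  generalize ∫ φ in levSet A h ∩ {φ | φ x < h}, φ x ∂gibbs c κ = I₀ at *
  generalize ∫ φ in (levSet A h)ᶜ ∩ {φ | φ x < h}, φ x ∂gibbs c κ = I₀' at *
  generalize ∫ φ in {φ | h ≤ φ x}, φ x ∂gibbs c κ = J at *
  generalize ∫ φ in {φ | φ x < h}, φ x ∂gibbs c κ = J' at *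
  obtain rfl : J' = -J := by linarith
  obtain rfl : I₀' = -J - I₀ := by linarith
  have e₁ : (gibbs c κ).real (levSet A h ∩ {φ | h ≤ φ x}) / (gibbs c κ).real {φ | h ≤ φ x} * J
      ≤ I₁ := by
    rw [div_mul_eq_mul_div, div_le_iff₀ hB]
    linarith
  have e₀ : -((gibbs c κ).real (levSet A h ∩ {φ | φ x < h}) / (gibbs c κ).real {φ | φ x < h} * J)
      ≤ I₀ := by
    rw [div_mul_eq_mul_div, neg_le, le_div_iff₀ hB']
    rw [← eq_sub_iff_add_eq'] at msplit
    rw [msplit] at key₀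
    linarith
  rw [← split, sub_mul]
  linarith

end SignLaw

/-! ### Truncated means of Gaussian measures -/

section Gaussian

open ProbabilityTheory

lemma integral_sq_gaussianReal (v : NNReal) : ∫ t, t ^ 2 ∂gaussianReal 0 v = v := by
  rw [← variance_fun_id_gaussianReal (μ := 0) (v := v),
    variance_of_integral_eq_zero (by fun_prop) (by simp)]

lemma gaussianReal_real_Icc_ge {M v₀ v₁ : ℝ} (hv₀ : 0 < v₀) {v : NNReal} (h₀ : v₀ ≤ v)
    (h₁ : v ≤ v₁) {a : ℝ} (ha : ∀ t ∈ Set.Icc a (a + 1), |t| ≤ M + 1) :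
    (√(2 * π * v₁))⁻¹ * exp (-(M + 1) ^ 2 / (2 * v₀))
      ≤ (gaussianReal 0 v).real (Set.Icc a (a + 1)) := by
  have hv : (0 : ℝ) < v := hv₀.trans_le h₀
  have hv' : v ≠ 0 := by exact_mod_cast hv.ne'
  rw [measureReal_def, gaussianReal_apply_eq_integral _ hv', ENNReal.toReal_ofReal
    (setIntegral_nonneg measurableSet_Icc fun t _ => gaussianPDFReal_nonneg 0 v t)]
  have hbound : ∀ t ∈ Set.Icc a (a + 1), (√(2 * π * v₁))⁻¹ * exp (-(M + 1) ^ 2 / (2 * v₀))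
      ≤ gaussianPDFReal 0 v t := fun t ht => by
    have ht : t ^ 2 ≤ (M + 1) ^ 2 := by
      rw [← sq_abs]
      exact pow_le_pow_left₀ (abs_nonneg t) (ha t ht) 2
    rw [gaussianPDFReal, sub_zero, neg_div, neg_div]
    gcongr
  have := setIntegral_mono_on (μ := volume) (integrableOn_const (by simp))
    (integrable_gaussianPDFReal 0 v).integrableOn measurableSet_Icc hbound
  simpa using this

/-- Lower bound for the truncated mean of a centred Gaussian measure. -/
lemma setIntegral_id_gaussianReal_ge {M v₀ v₁ : ℝ} (hM : 0 < M) (hv₀ : 0 < v₀) {v : NNReal}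
    (h₀ : v₀ ≤ v) (h₁ : v ≤ v₁) {h : ℝ} (hh : h ∈ Set.Ioo (-M) M) :
    M * ((√(2 * π * v₁))⁻¹ * exp (-(M + 1) ^ 2 / (2 * v₀)))
      ≤ ∫ t in {t | h ≤ t}, t ∂gaussianReal 0 v := by
  have hid : Integrable (fun t : ℝ => t) (gaussianReal 0 v) :=
    (memLp_id_gaussianReal 1).integrable le_rfl
  have key : ∀ (a : ℝ) (f : ℝ → ℝ) (S : Set ℝ), Integrable f (gaussianReal 0 v) →
      MeasurableSet S → (∀ t ∈ S, 0 ≤ f t) → Set.Icc a (a + 1) ⊆ S →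
      (∀ t ∈ Set.Icc a (a + 1), |t| ≤ M + 1 ∧ M ≤ f t) →
      M * ((√(2 * π * v₁))⁻¹ * exp (-(M + 1) ^ 2 / (2 * v₀)))
        ≤ ∫ t in S, f t ∂gaussianReal 0 v := fun a f S hf hS hpos hsub ha => by
    have hmono := setIntegral_mono_on (integrable_const M).integrableOn hf.integrableOn
      measurableSet_Icc fun t ht => (ha t ht).2
    rw [setIntegral_const, smul_eq_mul, mul_comm] at hmono
    calc _ ≤ M * (gaussianReal 0 v).real (Set.Icc a (a + 1)) :=
          mul_le_mul_of_nonneg_left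
            (gaussianReal_real_Icc_ge hv₀ h₀ h₁ fun t ht => (ha t ht).1) hM.le
      _ ≤ ∫ t in Set.Icc a (a + 1), f t ∂gaussianReal 0 v := hmono
      _ ≤ ∫ t in S, f t ∂gaussianReal 0 v :=
          setIntegral_mono_set hf.integrableOn
            ((ae_restrict_mem hS).mono hpos) hsub.eventuallyLE
  rcases le_or_gt 0 h with h0 | h0
  · refine key M _ _ hid measurableSet_Ici (fun t ht => h0.trans ht)
      (fun t ht => hh.2.le.trans ht.1) fun t ht => ⟨?_, ht.1⟩
    rw [abs_of_nonneg (hM.le.trans ht.1)]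
    exact ht.2
  · have hsum := integral_add_compl (measurableSet_Ici (a := h)) hid
    rw [integral_id_gaussianReal] at hsum
    have := key (-(M + 1)) (fun t => -t) (Set.Ici h)ᶜ hid.neg measurableSet_Ici.compl
      (fun t ht => by
        rw [Set.compl_Ici, Set.mem_Iio] at ht
        linarith)
      (fun t ht => by
        rw [Set.compl_Ici, Set.mem_Iio]
        linarith [ht.2, hh.1])
      fun t ht => ⟨abs_le.2 ⟨ht.1, by linarith [ht.2]⟩, by linarith [ht.2]⟩
    rw [integral_neg] at this
    change _ ≤ ∫ t in Set.Ici h, t ∂gaussianReal 0 v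
    linarith

lemma setIntegral_gibbs_ge {K : Type*} [Fintype K] {c : K → K → ℝ} {κ : K → ℝ}
    (hc : ∀ x y, 0 ≤ c x y) (hκ : ∀ x, 0 < κ x) {M v₀ v₁ : ℝ} (hM : 0 < M) (hv₀ : 0 < v₀) {x : K}
    (h₀ : v₀ ≤ ∫ φ, φ x ^ 2 ∂gibbs c κ) (h₁ : ∫ φ, φ x ^ 2 ∂gibbs c κ ≤ v₁) {h : ℝ}
    (hh : h ∈ Set.Ioo (-M) M) :
    M * ((√(2 * π * v₁))⁻¹ * exp (-(M + 1) ^ 2 / (2 * v₀)))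
      ≤ ∫ φ in {φ | h ≤ φ x}, φ x ∂gibbs c κ := by
  obtain ⟨v, hv⟩ := map_apply_gibbs hc hκ x
  have hm := measurable_pi_apply (X := fun _ : K => ℝ) x
  have hsq := integral_map (μ := gibbs c κ) hm.aemeasurable (f := fun t => t ^ 2) (by fun_prop)
  rw [hv, integral_sq_gaussianReal] at hsq
  rw [← hsq] at h₀ h₁
  refine (setIntegral_id_gaussianReal_ge hM hv₀ h₀ h₁ hh).trans_eq ?_
  rw [← hv]
  exact setIntegral_map measurableSet_Ici (by fun_prop) hm.aemeasurable

end Gaussian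

/-- **Differential inequality** (Corollary 4.4, eq. (4.10)):
`−(d/dh) μ(A^h) ≥ c · μ(A^h)(1 − μ(A^h)) · log(1/(2m))`, where `m` is the maximal
conditional influence, with `c = c(θ, M, v₀, v₁) > 0`. -/
theorem differential_inequality_general
    (θ M v₀ v₁ : ℝ) (hθ : θ ∈ Set.Ioo (0 : ℝ) 1) (hM : 0 < M)
    (hv₀ : 0 < v₀) (hv : v₀ ≤ v₁) :
    ∃ c₂ : ℝ, 0 < c₂ ∧
      ∀ (K : Type) [Fintype K] [Nonempty K]
        (c : K → K → ℝ), (∀ x y, c x y = c y x) → (∀ x y, 0 ≤ c x y) →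
        ∀ κ : K → ℝ, (∀ x, θ ≤ κ x) →
        ∀ E : (K → ℝ) → ℝ,
          (∀ φ : K → ℝ,
            E φ = (1 / 2) * ∑ x, ∑ y, c x y * (φ y - φ x) ^ 2 + ∑ x, κ x * (φ x) ^ 2) →
        ∀ Z : ℝ, Z = (∫ φ : K → ℝ, Real.exp (-(E φ) / 2)) →
        ∀ μ : Measure (K → ℝ),
          μ = volume.withDensity (fun φ => ENNReal.ofReal (Real.exp (-(E φ) / 2) / Z)) →
        (∀ x : K, v₀ ≤ (∫ φ : K → ℝ, (φ x) ^ 2 ∂μ) ∧ (∫ φ : K → ℝ, (φ x) ^ 2 ∂μ) ≤ v₁) →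
        ∀ A : Set (K → Bool),
          (∀ ω ω' : K → Bool, ω ∈ A → (∀ y, ω y ≤ ω' y) → ω' ∈ A) →
        ∀ h : ℝ, h ∈ Set.Ioo (-M) M →
          0 < (μ (levSet A h)).toReal → (μ (levSet A h)).toReal < 1 →
          ∀ m : ℝ,
            m = Finset.univ.sup' Finset.univ_nonempty (fun x => condInfl μ A h x) →
            0 < m →
            c₂ * ((μ (levSet A h)).toReal * (1 - (μ (levSet A h)).toReal)
                * Real.log (1 / (2 * m)))
              ≤ -(deriv (fun h' : ℝ => (μ (levSet A h')).toReal) h) := by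
  have hv₁ : 0 < v₁ := hv₀.trans_le hv
  let c₁ := M * ((√(2 * π * v₁))⁻¹ * exp (-(M + 1) ^ 2 / (2 * v₀)))
  have hc₁ : 0 < c₁ := by positivity
  refine ⟨θ * c₁ / 4, by have := hθ.1; positivity, ?_⟩
  intro K _ _ c _ hc κ hκθ E hE Z hZ μ hμ hvar A hA h hh _ _ m hm hm0
  classical
  have hκ : ∀ x, 0 < κ x := fun x => hθ.1.trans_le (hκθ x)
  obtain rfl : E = energy c κ := funext hE
  obtain rfl : μ = gibbs c κ := by rw [hμ, hZ]; rfl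
  have hup : IsUpperSet A := fun ω ω' hle hω => hA ω ω' hω hle
  have := isProbabilityMeasure_signLaw hc hκ h
  have hpos := signLaw_agreeOff_pos hc hκ h
  have hlat := signLaw_lattice hc hκ h
  have htal := variance_mul_log_le_sum_bitInfluence hpos hlat hup hm0 fun x => by
    rw [← condInfl_gibbs, hm]
    exact Finset.le_sup' (fun x => condInfl (gibbs c κ) A h x) (Finset.mem_univ x)
  rw [signLaw_real] at htal
  have hsum : θ * c₁ * ∑ x, bitInfluence (signLaw c κ h) A x
      ≤ ∑ x, κ x * ∫ φ in levSet A h, φ x ∂gibbs c κ := by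
    rw [Finset.mul_sum]
    refine Finset.sum_le_sum fun x _ => ?_
    have hnn := bitInfluence_nonneg hpos hlat hup x
    have hle := condInfl_mul_setIntegral_le hc hκ hup h x
    rw [condInfl_gibbs] at hle
    rw [mul_assoc]
    refine mul_le_mul (hκθ x) (le_trans ?_ hle) (by positivity) (hκ x).le
    rw [mul_comm]
    exact mul_le_mul_of_nonneg_left
      (setIntegral_gibbs_ge hc hκ hM hv₀ (hvar x).1 (hvar x).2 hh) hnn
  have hderiv := (hasDerivAt_gibbs_levSet hc hκ A h).deriv
  simp only [measureReal_def] at hderiv htal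
  rw [hderiv, neg_neg]
  calc _ = θ * c₁ / 4 * _ := rfl
    _ ≤ θ * c₁ / 4 * (4 * ∑ x, bitInfluence (signLaw c κ h) A x) :=
      mul_le_mul_of_nonneg_left htal (by have := hθ.1; positivity)
    _ = θ * c₁ * ∑ x, bitInfluence (signLaw c κ h) A x := by ring
    _ ≤ _ := hsum
end

section
/- Let a < b be real numbers, α ≥ 0, and let q : ℝ → ℝ be differentiable on [a, b] with 0 < q(h) < 1 for all h ∈ [a, b]. If deriv q h ≤ −α · q(h)·(1 − q(h)) for all h ∈ [a, b], then q(a)/(1 − q(a)) ≥ exp(α·(b − a)) · q(b)/(1 − q(b)). (Integrated differential inequality, equation (5.8) of the paper, using that d/dx log(x/(1−x)) = 1/(x(1−x)).) -/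
open Real

/-- **Integrated differential inequality** (equation (5.8)): if
`q' ≤ −α·q(1−q)` on `[a, b]` with `0 < q < 1` there, then
`q(a)/(1−q(a)) ≥ e^{α(b−a)} · q(b)/(1−q(b))`. -/
theorem integrated_differential_inequality
    (a b α : ℝ) (hab : a < b) (hα : 0 ≤ α)
    (q : ℝ → ℝ)
    (hdiff : ∀ h ∈ Set.Icc a b, DifferentiableAt ℝ q h)
    (hq : ∀ h ∈ Set.Icc a b, 0 < q h ∧ q h < 1)
    (hineq : ∀ h ∈ Set.Icc a b, deriv q h ≤ -α * (q h * (1 - q h))) :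
    Real.exp (α * (b - a)) * (q b / (1 - q b)) ≤ q a / (1 - q a) := by
  have hderiv : ∀ x ∈ Set.Icc a b,
      HasDerivAt (fun h => Real.exp (α * (h - a)) * (q h / (1 - q h)))
        (Real.exp (α * (x - a)) * ((deriv q x + α * (q x * (1 - q x))) / (1 - q x) ^ 2)) x := by
    intro x hx
    have hne : 1 - q x ≠ 0 := (sub_pos.2 (hq x hx).2).ne'
    have hqx := (hdiff x hx).hasDerivAt
    have hexp := (((hasDerivAt_id x).sub_const a).const_mul α).exp
    refine (hexp.mul (hqx.div (hqx.const_sub 1) hne)).congr_deriv ?_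
    simp only [id_eq, Pi.div_apply]
    field_simp
    ring
  have hanti : AntitoneOn (fun h => Real.exp (α * (h - a)) * (q h / (1 - q h)))
      (Set.Icc a b) := by
    refine antitoneOn_of_hasDerivWithinAt_nonpos (convex_Icc a b)
      (fun x hx => (hderiv x hx).continuousAt.continuousWithinAt)
      (fun x hx => (hderiv x (interior_subset hx)).hasDerivWithinAt) fun x hx => ?_
    have hle := hineq x (interior_subset hx)
    exact mul_nonpos_of_nonneg_of_nonpos (Real.exp_pos _).le
      (div_nonpos_of_nonpos_of_nonneg (by linarith) (sq_nonneg _))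
  simpa using hanti (Set.left_mem_Icc.2 hab.le) (Set.right_mem_Icc.2 hab.le) hab.le
end

section
/- Define t : ℕ → ℝ by t 0 = 0, t 1 = 1, and t (k+1) = t k + 1/(t k) for k ≥ 1. Then for every k ≥ 2, t(k+1)² − t(k−1)² ≤ (1 + t(k+1)/t(k)) · (1 + t(k)/t(k−1)), and consequently limsup_{k→∞} ( t(k+1)² − t(k−1)² ) ≤ 4; in particular the sequence k ↦ t(k+1)² − t(k−1)² is bounded above. -/
open Filter

/-- Terms of a sequence with `t 1 = 1` and `t (k + 1) = t k + 1 / t k` are positive, and their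
squares grow at least linearly. -/
theorem mesh_sequence_pos_and_le_sq (t : ℕ → ℝ) (h1 : t 1 = 1)
    (hrec : ∀ k : ℕ, 1 ≤ k → t (k + 1) = t k + 1 / t k) (n : ℕ) :
    1 ≤ t (n + 1) ∧ (n : ℝ) ≤ t (n + 1) ^ 2 := by
  induction n with
  | zero => simp [h1]
  | succ n ih =>
    obtain ⟨hpos, hsq⟩ := ih
    have hinv : 0 < 1 / t (n + 1) := by positivity
    have hmul : t (n + 1) * (1 / t (n + 1)) = 1 := mul_one_div_cancel (by positivity)
    rw [hrec (n + 1) (by omega)]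
    refine ⟨by linarith, ?_⟩
    push_cast
    nlinarith

theorem mesh_sequence_sq_sub_sq (t : ℕ → ℝ) (h1 : t 1 = 1)
    (hrec : ∀ k : ℕ, 1 ≤ k → t (k + 1) = t k + 1 / t k) (n : ℕ) :
    t (n + 3) ^ 2 - t (n + 1) ^ 2 = 4 + (t (n + 2) ^ 2)⁻¹ + (t (n + 1) ^ 2)⁻¹ := by
  have ha := (mesh_sequence_pos_and_le_sq t h1 hrec n).1
  have hb : 1 ≤ t (n + 2) := (mesh_sequence_pos_and_le_sq t h1 hrec (n + 1)).1
  have hstep : ∀ x : ℝ, 1 ≤ x → (x + 1 / x) ^ 2 = x ^ 2 + 2 + (x ^ 2)⁻¹ := by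
    intro x hx
    field_simp
    ring
  have hb2 := hstep _ ha
  rw [← hrec (n + 1) (by omega)] at hb2
  rw [hrec (n + 2) (by omega), hstep _ hb]
  linarith

/-- **Bound on consecutive squared gaps of the mesh sequence** `t 0 = 0`, `t 1 = 1`,
`t(k+1) = t k + 1/(t k)`: for `k ≥ 2`,
`t(k+1)² − t(k−1)² ≤ (1 + t(k+1)/t k)·(1 + t k/t(k−1))`, hence
`limsup_k (t(k+1)² − t(k−1)²) ≤ 4`, and in particular this sequence is bounded above. -/
theorem mesh_sequence_squared_gaps
    (t : ℕ → ℝ) (h0 : t 0 = 0) (h1 : t 1 = 1)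
    (hrec : ∀ k : ℕ, 1 ≤ k → t (k + 1) = t k + 1 / t k) :
    (∀ k : ℕ, 2 ≤ k →
      t (k + 1) ^ 2 - t (k - 1) ^ 2 ≤ (1 + t (k + 1) / t k) * (1 + t k / t (k - 1))) ∧
    limsup (fun k : ℕ => t (k + 1) ^ 2 - t (k - 1) ^ 2) atTop ≤ 4 ∧
    BddAbove (Set.range fun k : ℕ => t (k + 1) ^ 2 - t (k - 1) ^ 2) := by
  have hinv : Tendsto (fun n : ℕ => (t (n + 1) ^ 2)⁻¹) atTop (nhds 0) :=
    (tendsto_atTop_mono (fun n => (mesh_sequence_pos_and_le_sq t h1 hrec n).2)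
      tendsto_natCast_atTop_atTop).inv_tendsto_atTop
  have hlim : Tendsto (fun k : ℕ => t (k + 1) ^ 2 - t (k - 1) ^ 2) atTop (nhds 4) := by
    rw [← tendsto_add_atTop_iff_nat 2]
    have h := ((tendsto_const_nhds (x := (4 : ℝ))).add
      ((tendsto_add_atTop_iff_nat 1).2 hinv)).add hinv
    simp only [add_zero] at h
    exact h.congr fun n => (mesh_sequence_sq_sub_sq t h1 hrec n).symm
  refine ⟨fun k hk => ?_, hlim.limsup_eq.le, hlim.bddAbove_range⟩
  obtain ⟨n, rfl⟩ := Nat.exists_eq_add_of_le' hk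
  change t (n + 3) ^ 2 - t (n + 1) ^ 2 ≤ (1 + t (n + 3) / t (n + 2)) * (1 + t (n + 2) / t (n + 1))
  have hratio : ∀ m : ℕ, t (m + 2) / t (m + 1) = 1 + (t (m + 1) ^ 2)⁻¹ := by
    intro m
    have hm := (mesh_sequence_pos_and_le_sq t h1 hrec m).1
    rw [hrec (m + 1) (by omega)]
    field_simp
  rw [mesh_sequence_sq_sub_sq t h1 hrec n, hratio n, hratio (n + 1)]
  have hx : 0 ≤ (t (n + 1) ^ 2)⁻¹ := by positivity
  have hy : 0 ≤ (t (n + 1 + 1) ^ 2)⁻¹ := by positivity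
  nlinarith [mul_nonneg hx hy]
end

section
/- Define t : ℕ → ℝ by t 0 = 0, t 1 = 1, and t (k+1) = t k + 1/(t k) for k ≥ 1. For all 0 < v₀ ≤ v₁ there exists a constant c > 0, depending only on v₀ and v₁, such that for every variance v ∈ [v₀, v₁] and every k ≥ 1, the centered Gaussian measure μ_v = gaussianReal 0 v on ℝ satisfies μ_v( [t k, t (k+1)) ) ≥ c · μ_v( (t (k−1), ∞) ). In particular, ∫ s·1_{[t k, t(k+1))}(s) dμ_v(s) ≥ c · μ_v( (t (k−1), ∞) ) for all k ≥ 1. -/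
open MeasureTheory ProbabilityTheory

/-- Exponential bound on the upper tail of a centered Gaussian, the exponential rate `a` being
controlled through `a * s - 1 ≤ 2 * b * s + s ^ 2`. -/
lemma gaussianReal_Ioi_toReal_le {v : NNReal} (hv : v ≠ 0) {a b : ℝ} (ha : 0 < a)
    (h : ∀ s : ℝ, 0 ≤ s → a * s - 1 ≤ 2 * b * s + s ^ 2) :
    (gaussianReal 0 v (Set.Ioi b)).toReal ≤
      (√(2 * Real.pi * v))⁻¹ * (Real.exp ((1 - b ^ 2) / (2 * v)) * (2 * v / a)) := by
  have hv' : (0 : ℝ) < v := by positivity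
  have hneg : -(a / (2 * v)) < 0 := by rw [neg_lt_zero]; positivity
  rw [gaussianReal_apply_eq_integral 0 hv, ENNReal.toReal_ofReal
    (setIntegral_nonneg measurableSet_Ioi fun x _ ↦ gaussianPDFReal_nonneg 0 v x)]
  calc ∫ x in Set.Ioi b, gaussianPDFReal 0 v x
      ≤ ∫ x in Set.Ioi b, (√(2 * Real.pi * v))⁻¹ * (Real.exp ((1 - b ^ 2 + a * b) / (2 * v))
          * Real.exp (-(a / (2 * v)) * x)) := by
        refine setIntegral_mono_on (integrable_gaussianPDFReal 0 v).integrableOn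
          (((integrableOn_exp_mul_Ioi hneg b).const_mul _).const_mul _) measurableSet_Ioi
          fun x hx ↦ ?_
        rw [gaussianPDFReal, ← Real.exp_add]
        have hs := h (x - b) (sub_nonneg.2 (le_of_lt hx))
        have heq : (1 - b ^ 2 + a * b) / (2 * v) + -(a / (2 * v)) * x
            = (1 - b ^ 2 - a * (x - b)) / (2 * v) := by ring
        rw [heq]
        gcongr
        nlinarith
    _ = _ := by
        rw [integral_const_mul, integral_const_mul, integral_exp_mul_Ioi hneg, neg_div_neg_eq]
        congr 1
        rw [mul_div_assoc', ← Real.exp_add, div_div_eq_mul_div, mul_div_assoc]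
        congr 2
        ring

/-- The mass of `[a, a + 1 / a)` under a centered Gaussian is at least the length of the interval
times a lower bound for the density on it. -/
lemma le_gaussianReal_Ico_toReal {v : NNReal} (hv : v ≠ 0) {a : ℝ} (ha : 1 ≤ a) :
    (√(2 * Real.pi * v))⁻¹ * Real.exp (-(a ^ 2 + 3) / (2 * v)) * (1 / a) ≤
      (gaussianReal 0 v (Set.Ico a (a + 1 / a))).toReal := by
  have ha0 : 0 < a := by linarith
  rw [gaussianReal_apply_eq_integral 0 hv, ENNReal.toReal_ofReal
    (setIntegral_nonneg measurableSet_Ico fun x _ ↦ gaussianPDFReal_nonneg 0 v x)]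
  have hconst := setIntegral_mono_on (μ := volume) (s := Set.Ico a (a + 1 / a))
    (f := fun _ ↦ (√(2 * Real.pi * v))⁻¹ * Real.exp (-(a ^ 2 + 3) / (2 * v)))
    (integrableOn_const (by simp)) (integrable_gaussianPDFReal 0 v).integrableOn measurableSet_Ico fun x hx ↦ by
      rw [gaussianPDFReal]
      have hinv : 1 / a ≤ 1 := (div_le_one ha0).2 ha
      have hmul : a * (1 / a) = 1 := by field_simp
      have hinv0 : 0 < 1 / a := by positivity
      have hx' : x ^ 2 ≤ (a + 1 / a) ^ 2 :=
        pow_le_pow_left₀ (ha0.le.trans hx.1) hx.2.le 2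
      have : x ^ 2 ≤ a ^ 2 + 3 := by nlinarith
      gcongr
      simpa using this
  refine le_trans (le_of_eq ?_) hconst
  have hlen : 0 ≤ a⁻¹ := by positivity
  simp [hlen, mul_comm]

/-- If `a` and `b` are consecutive mesh points up to bounded distortion, the Gaussian mass of
`[a, a + 1 / a)` is comparable to that of `(b, ∞)`. -/
lemma mul_gaussianReal_Ioi_le_Ico {v : NNReal} (hv : v ≠ 0) {a b : ℝ} (ha : 1 ≤ a)
    (hab : a ^ 2 ≤ b ^ 2 + 3) (h : ∀ s : ℝ, 0 ≤ s → a * s - 1 ≤ 2 * b * s + s ^ 2) :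
    Real.exp (-7 / (2 * v)) / (2 * v) * (gaussianReal 0 v (Set.Ioi b)).toReal ≤
      (gaussianReal 0 v (Set.Ico a (a + 1 / a))).toReal := by
  have hv' : (0 : ℝ) < v := by positivity
  have ha0 : 0 < a := by linarith
  calc _ ≤ Real.exp (-7 / (2 * v)) / (2 * v) * ((√(2 * Real.pi * v))⁻¹ *
          (Real.exp ((1 - b ^ 2) / (2 * v)) * (2 * v / a))) := by
        gcongr
        exact gaussianReal_Ioi_toReal_le hv ha0 h
    _ = (√(2 * Real.pi * v))⁻¹ * Real.exp (-(b ^ 2 + 6) / (2 * v)) * (1 / a) := by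
        rw [show -(b ^ 2 + 6) / (2 * (v : ℝ)) = -7 / (2 * v) + (1 - b ^ 2) / (2 * v) by ring,
          Real.exp_add]
        field_simp
    _ ≤ (√(2 * Real.pi * v))⁻¹ * Real.exp (-(a ^ 2 + 3) / (2 * v)) * (1 / a) := by
        gcongr ?_ * Real.exp (?_ / _) * _
        linarith
    _ ≤ _ := le_gaussianReal_Ico_toReal hv ha

lemma gaussianReal_Ico_toReal_le_setIntegral (v : NNReal) {a b : ℝ} (ha : 1 ≤ a) :
    (gaussianReal 0 v (Set.Ico a b)).toReal ≤
      ∫ s in Set.Ico a b, s ∂(gaussianReal 0 v) := by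
  have hid : Integrable (fun s : ℝ ↦ s) (gaussianReal 0 v) :=
    memLp_one_iff_integrable.1 (memLp_id_gaussianReal 1)
  have := setIntegral_mono_on (μ := gaussianReal 0 v) (s := Set.Ico a b) (f := fun _ ↦ (1 : ℝ))
    (integrable_const _).integrableOn hid.integrableOn measurableSet_Ico
    fun x hx ↦ ha.trans hx.1
  simpa [Measure.real] using this

lemma one_le_of_mesh_rec {t : ℕ → ℝ} (h1 : t 1 = 1)
    (hrec : ∀ k : ℕ, 1 ≤ k → t (k + 1) = t k + 1 / t k) {k : ℕ} (hk : 1 ≤ k) : 1 ≤ t k := by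
  induction k, hk using Nat.le_induction with
  | base => exact h1.ge
  | succ k hk ih =>
    rw [hrec k hk]
    have : 0 ≤ 1 / t k := by positivity
    linarith

/-- **Uniform Gaussian mass of the mesh intervals** (proof of Proposition 4.3): for the
mesh sequence `t 0 = 0`, `t 1 = 1`, `t(k+1) = t k + 1/(t k)` and variances `v ∈ [v₀, v₁]`,
there is `c = c(v₀, v₁) > 0` with
`μ_v([t k, t(k+1))) ≥ c · μ_v((t(k−1), ∞))` for all `k ≥ 1`; in particular
`∫ s·1_{[t k, t(k+1))}(s) dμ_v(s) ≥ c · μ_v((t(k−1), ∞))`. -/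
theorem gaussian_mass_of_mesh_intervals
    (t : ℕ → ℝ) (h0 : t 0 = 0) (h1 : t 1 = 1)
    (hrec : ∀ k : ℕ, 1 ≤ k → t (k + 1) = t k + 1 / t k)
    (v₀ v₁ : NNReal) (hv₀ : 0 < v₀) (hv : v₀ ≤ v₁) :
    ∃ c : ℝ, 0 < c ∧
      ∀ v : NNReal, v ∈ Set.Icc v₀ v₁ → ∀ k : ℕ, 1 ≤ k →
        c * (gaussianReal 0 v (Set.Ioi (t (k - 1)))).toReal
            ≤ (gaussianReal 0 v (Set.Ico (t k) (t (k + 1)))).toReal ∧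
        c * (gaussianReal 0 v (Set.Ioi (t (k - 1)))).toReal
            ≤ ∫ s in Set.Ico (t k) (t (k + 1)), s ∂(gaussianReal 0 v) := by
  have hv₀' : (0 : ℝ) < v₀ := by exact_mod_cast hv₀
  have hv₁' : (0 : ℝ) < v₁ := by exact_mod_cast hv₀.trans_le hv
  refine ⟨Real.exp (-7 / (2 * v₀)) / (2 * v₁), by positivity, fun v hvI k hk ↦ ?_⟩
  have hvpos : 0 < v := hv₀.trans_le hvI.1
  have hv' : (0 : ℝ) < v := by exact_mod_cast hvpos
  have hlo : (v₀ : ℝ) ≤ v := by exact_mod_cast hvI.1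
  have hhi : (v : ℝ) ≤ v₁ := by exact_mod_cast hvI.2
  have hc : Real.exp (-7 / (2 * v₀)) / (2 * v₁) ≤ Real.exp (-7 / (2 * v)) / (2 * v) := by
    rw [neg_div, neg_div]
    gcongr
  have hone : 1 ≤ t k := one_le_of_mesh_rec h1 hrec hk
  have hgeom : t k ^ 2 ≤ t (k - 1) ^ 2 + 3 ∧
      ∀ s : ℝ, 0 ≤ s → t k * s - 1 ≤ 2 * t (k - 1) * s + s ^ 2 := by
    obtain ⟨j, rfl⟩ : ∃ j, k = j + 1 := ⟨k - 1, by omega⟩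
    rw [Nat.add_sub_cancel]
    rcases Nat.eq_zero_or_pos j with rfl | hj
    · rw [zero_add, h1, h0]
      exact ⟨by norm_num, fun s _ ↦ by nlinarith [sq_nonneg (s - 1)]⟩
    · have hb : 1 ≤ t j := one_le_of_mesh_rec h1 hrec hj
      have hb0 : 0 < t j := by linarith
      have hinv : 1 / t j ≤ 1 := (div_le_one hb0).2 hb
      have hmul : t j * (1 / t j) = 1 := by field_simp
      have hinv0 : 0 < 1 / t j := by positivity
      rw [hrec j hj]
      exact ⟨by nlinarith, fun s hs ↦ by nlinarith [sq_nonneg s]⟩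
  have hmass : Real.exp (-7 / (2 * v₀)) / (2 * v₁) *
      (gaussianReal 0 v (Set.Ioi (t (k - 1)))).toReal ≤
        (gaussianReal 0 v (Set.Ico (t k) (t (k + 1)))).toReal := by
    rw [hrec k hk]
    exact (mul_le_mul_of_nonneg_right hc ENNReal.toReal_nonneg).trans
      (mul_gaussianReal_Ioi_le_Ico hvpos.ne' hone hgeom.1 hgeom.2)
  exact ⟨hmass, hmass.trans (gaussianReal_Ico_toReal_le_setIntegral v hone)⟩
end

section
/- For all 0 < v₀ ≤ v₁ and M > 0 there exists a constant C > 0, depending only on v₀, v₁, M, such that for every variance v ∈ [v₀, v₁], every h ∈ [0, M], and every t ≥ 0, the centered Gaussian measure μ_v = gaussianReal 0 v on ℝ satisfies μ_v( (max t h, ∞) ) / μ_v( [h, ∞) ) + ( μ_v( (−∞, −t) ) + μ_v( (t, h) ) ) / μ_v( (−∞, h] ) ≤ C · μ_v( (t, ∞) ). (Tail estimate for the conditioned variables U ~ φ | φ ≥ h and V ~ φ | φ ≤ h used in the proof of Proposition 4.3: the law of W = max(|U|, |V|) has Gaussian tails, uniformly in h ∈ [0, M].) -/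
open MeasureTheory ProbabilityTheory

/-- For a centred Gaussian, the mass of a right tail beyond a nonnegative level is monotone in the
variance. -/
lemma gaussianReal_zero_Ioi_mono {v w : NNReal} (hv : 0 < v) (hvw : v ≤ w) {M : ℝ} (hM : 0 ≤ M) :
    gaussianReal 0 v (Set.Ioi M) ≤ gaussianReal 0 w (Set.Ioi M) := by
  have hv' : (0 : ℝ) < v := by exact_mod_cast hv
  have hk : 1 ≤ √((w : ℝ) / v) := by
    rw [Real.one_le_sqrt, one_le_div hv']
    exact_mod_cast hvw
  have hmap : (gaussianReal 0 v).map (√((w : ℝ) / v) * ·) = gaussianReal 0 w := by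
    rw [gaussianReal_map_const_mul, mul_zero]
    congr 1
    ext
    simp only [NNReal.coe_mul, NNReal.coe_mk]
    rw [Real.sq_sqrt (by positivity)]
    field_simp
  rw [← hmap, Measure.map_apply (by fun_prop) measurableSet_Ioi]
  refine measure_mono fun x hx => ?_
  simp only [Set.mem_preimage, Set.mem_Ioi] at hx ⊢
  nlinarith

/-- A centred Gaussian is symmetric: opposite tails have the same mass. -/
lemma gaussianReal_zero_Iio_neg (v : NNReal) (t : ℝ) :
    gaussianReal 0 v (Set.Iio (-t)) = gaussianReal 0 v (Set.Ioi t) := by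
  have hmap : (gaussianReal 0 v).map (fun x => -x) = gaussianReal 0 v := by
    rw [gaussianReal_map_neg, neg_zero]
  conv_rhs => rw [← hmap, Measure.map_apply measurable_neg measurableSet_Ioi]
  congr 1
  ext x
  simp

lemma gaussianReal_Ioi_pos (m : ℝ) {v : NNReal} (hv : v ≠ 0) (M : ℝ) :
    0 < gaussianReal m v (Set.Ioi M) := by
  refine pos_iff_ne_zero.2 fun h => ?_
  have := gaussianReal_absolutelyContinuous' m hv h
  simp at this

/-- **Uniform Gaussian tail estimate for the conditioned variables** (proof of
Proposition 4.3): for variances `v ∈ [v₀, v₁]` and `h ∈ [0, M]`, there is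
`C = C(v₀, v₁, M) > 0` such that for all `t ≥ 0`,
`μ_v((max(t,h), ∞))/μ_v([h, ∞)) + (μ_v((−∞, −t)) + μ_v((t, h)))/μ_v((−∞, h])
  ≤ C · μ_v((t, ∞))`. -/
theorem gaussian_conditioned_tail_estimate
    (v₀ v₁ : NNReal) (hv₀ : 0 < v₀) (hv : v₀ ≤ v₁) (M : ℝ) (hM : 0 < M) :
    ∃ C : ℝ, 0 < C ∧
      ∀ v : NNReal, v ∈ Set.Icc v₀ v₁ →
      ∀ h ∈ Set.Icc (0 : ℝ) M, ∀ t : ℝ, 0 ≤ t →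
        (gaussianReal 0 v (Set.Ioi (max t h))).toReal
            / (gaussianReal 0 v (Set.Ici h)).toReal
          + ((gaussianReal 0 v (Set.Iio (-t))).toReal
              + (gaussianReal 0 v (Set.Ioo t h)).toReal)
            / (gaussianReal 0 v (Set.Iic h)).toReal
          ≤ C * (gaussianReal 0 v (Set.Ioi t)).toReal := by
  let c : ℝ := (gaussianReal 0 v₀).real (Set.Ioi M)
  have hc : 0 < c := ENNReal.toReal_pos (gaussianReal_Ioi_pos 0 hv₀.ne' M).ne' (measure_ne_top _ _)
  refine ⟨3 / c, by positivity, ?_⟩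
  rintro v ⟨hv₀v, -⟩ h ⟨hh₀, hhM⟩ t -
  simp only [← measureReal_def]
  set μ := gaussianReal 0 v
  have hcM : c ≤ μ.real (Set.Ioi M) :=
    ENNReal.toReal_mono (measure_ne_top _ _) (gaussianReal_zero_Ioi_mono hv₀ hv₀v hM.le)
  have hsymm (s : ℝ) : μ.real (Set.Iio (-s)) = μ.real (Set.Ioi s) :=
    congrArg ENNReal.toReal (gaussianReal_zero_Iio_neg v s)
  have hIci : c ≤ μ.real (Set.Ici h) :=
    hcM.trans (measureReal_mono ((Set.Ioi_subset_Ioi hhM).trans Set.Ioi_subset_Ici_self))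
  have hIic : c ≤ μ.real (Set.Iic h) := by
    rw [← hsymm] at hcM
    refine hcM.trans (measureReal_mono fun x hx => ?_)
    simp only [Set.mem_Iio, Set.mem_Iic] at hx ⊢
    linarith
  have hmax : μ.real (Set.Ioi (max t h)) ≤ μ.real (Set.Ioi t) :=
    measureReal_mono (Set.Ioi_subset_Ioi (le_max_left t h))
  have hIoo : μ.real (Set.Ioo t h) ≤ μ.real (Set.Ioi t) :=
    measureReal_mono Set.Ioo_subset_Ioi_self
  rw [hsymm]
  calc _ ≤ μ.real (Set.Ioi t) / c + (μ.real (Set.Ioi t) + μ.real (Set.Ioi t)) / c := by gcongr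
    _ = 3 / c * μ.real (Set.Ioi t) := by ring
end
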